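/- arXiv:2503.00843 — 2 statements merged into one kernel-verified Lean document; each statement's English description precedes it below -/
import Mathlib

section
/- Let n be a positive integer with n ≡ 3 (mod 4). Then the only solutions in positive integers x, y, z, w of the equation n^x + (n+1)^y + (n+2)^z = (n+3)^w occur for n = 3, and they are (x, y, z, w) = (3, 1, 1, 2) and (x, y, z, w) = (3, 3, 3, 3). -/
lemma dvd_conv {a b a' b' : ℤ} (h : a ∣ b) (ha : a' = a) (hb : b' = b) : a' ∣ b' := by
  rw [ha, hb]; exact h

/-- First two terms of the binomial expansion. -/
lemma binom_two (t : ℤ) (m : ℕ) : t ^ 2 ∣ (1 + t) ^ m - 1 - m * t := by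
  induction m with
  | zero => simp
  | succ m ih =>
    obtain ⟨c, hc⟩ := ih
    refine ⟨c * (1 + t) + m, ?_⟩
    have : (1 + t) ^ m = t ^ 2 * c + 1 + m * t := by linarith
    rw [pow_succ, this]
    push_cast
    ring

/-- If `2^k+1` divides `2^m+1` then `m` is an odd multiple of `k`. -/
lemma ord_two (k m : ℕ) (hk : 1 ≤ k) (h : (2 ^ k + 1 : ℤ) ∣ 2 ^ m + 1) :
    ∃ a, a % 2 = 1 ∧ m = k * a := by
  have hr : m % k < k := Nat.mod_lt _ hk
  have hm := Nat.div_add_mod m k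
  set a := m / k
  set r := m % k
  have h1 : (2 ^ k + 1 : ℤ) ∣ (2 ^ k) ^ a - (-1) ^ a := by
    have := sub_dvd_pow_sub_pow (2 ^ k : ℤ) (-1) a
    simpa using this
  have h2 : (2 ^ k + 1 : ℤ) ∣ (-1) ^ a * 2 ^ r + 1 := by
    have e : ((-1) ^ a * 2 ^ r + 1 : ℤ) = (2 ^ m + 1) - ((2 ^ k) ^ a - (-1) ^ a) * 2 ^ r := by
      rw [← hm, pow_add, pow_mul]; ring
    rw [e]
    exact dvd_sub h (Dvd.dvd.mul_right h1 _)
  have hlt : (2 : ℤ) ^ r < 2 ^ k := pow_lt_pow_right₀ (by norm_num) hr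
  have hpos : (1 : ℤ) ≤ 2 ^ r := one_le_pow₀ (by norm_num)
  rcases Nat.even_or_odd a with ha | ha
  · rw [ha.neg_one_pow] at h2
    have := Int.le_of_dvd (by linarith) h2
    linarith
  · rw [ha.neg_one_pow] at h2
    have h3 : (2 ^ k + 1 : ℤ) ∣ 2 ^ r - 1 := by
      have := (dvd_neg (α := ℤ)).2 h2
      exact dvd_conv this (by ring) (by ring)
    have h4 : (2 : ℤ) ^ r - 1 = 0 := by
      by_contra hne
      have := Int.le_of_dvd (by omega) h3
      linarith
    have h5 : r = 0 := by
      by_contra hne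
      have : (2 : ℤ) ^ 1 ≤ 2 ^ r := pow_le_pow_right₀ (by norm_num) (by omega)
      linarith
    exact ⟨a, Nat.odd_iff.1 ha, by omega⟩

/-- Size comparison. -/
lemma size_cmp (k n : ℕ) (hk : 4 ≤ k) (hn : n + 1 = 2 ^ k) :
    (n + 3) ^ (k + 1) ≤ n ^ (k + 2) := by
  have h16 : 2 ^ 4 ≤ 2 ^ k := Nat.pow_le_pow_right (by norm_num) hk
  have h1 : 5 * (n + 3) ≤ 6 * n := by omega
  have h2 : 6 ^ (k + 1) + 5 ^ (k + 1) ≤ 5 ^ (k + 1) * 2 ^ k := by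
    clear h1 h16 hn
    induction k, hk using Nat.le_induction with
    | base => norm_num
    | succ k hk ih =>
      have e1 : 6 ^ (k + 1 + 1) = 6 * 6 ^ (k + 1) := by ring
      have e2 : 5 ^ (k + 1 + 1) = 5 * 5 ^ (k + 1) := by ring
      have e3 : 5 ^ (k + 1 + 1) * 2 ^ (k + 1) = 10 * (5 ^ (k + 1) * 2 ^ k) := by ring
      rw [e3, e1, e2]
      omega
  have h3 : 6 ^ (k + 1) ≤ 5 ^ (k + 1) * n := by
    rw [← hn, mul_add] at h2
    omega
  have h4 : (5 * (n + 3)) ^ (k + 1) ≤ (6 * n) ^ (k + 1) := Nat.pow_le_pow_left h1 _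
  rw [mul_pow, mul_pow] at h4
  have h5 : 5 ^ (k + 1) * (n + 3) ^ (k + 1) ≤ 5 ^ (k + 1) * n ^ (k + 2) := by
    calc 5 ^ (k + 1) * (n + 3) ^ (k + 1) ≤ 6 ^ (k + 1) * n ^ (k + 1) := h4
      _ ≤ (5 ^ (k + 1) * n) * n ^ (k + 1) := Nat.mul_le_mul_right _ h3
      _ = 5 ^ (k + 1) * n ^ (k + 2) := by ring
  exact Nat.le_of_mul_le_mul_left h5 (by positivity)

/-- Reducing exponents modulo `c`, for positive exponents. -/
lemma red_exp (Q c b e : ℕ) (hb : b ^ (c + 1) ≡ b [MOD Q]) (he : 0 < e) :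
    b ^ e ≡ b ^ ((e - 1) % c + 1) [MOD Q] := by
  have key : ∀ t r, b ^ (c * t + r + 1) ≡ b ^ (r + 1) [MOD Q] := by
    intro t r
    induction t with
    | zero => simp; rfl
    | succ t ih =>
      have e1 : b ^ (c * (t + 1) + r + 1) = b ^ (c + 1) * b ^ (c * t + r) := by
        rw [← pow_add]; congr 1; ring
      rw [e1]
      refine (hb.mul_right _).trans ?_
      have e2 : b * b ^ (c * t + r) = b ^ (c * t + r + 1) := by rw [pow_succ]; ring
      rw [e2]; exact ih
  have h := key ((e - 1) / c) ((e - 1) % c)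
  rw [Nat.div_add_mod] at h
  rwa [Nat.sub_add_cancel he] at h

lemma fermat455 (b : ℕ) : b ^ 13 ≡ b [MOD 455] := by
  have h : ∀ r < 455, r ^ 13 % 455 = r := by decide +kernel
  have := h (b % 455) (Nat.mod_lt _ (by norm_num))
  unfold Nat.ModEq
  rw [Nat.pow_mod]; exact this

lemma fermat703 (b : ℕ) : b ^ 37 ≡ b [MOD 703] := by
  have h : ∀ r < 703, r ^ 37 % 703 = r := by decide +kernel
  have := h (b % 703) (Nat.mod_lt _ (by norm_num))
  unfold Nat.ModEq
  rw [Nat.pow_mod]; exact this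

/-- Reduction of the whole equation. -/
lemma red_eq (Q c k n x y z w : ℕ) (hQ : ∀ b : ℕ, b ^ (c + 1) ≡ b [MOD Q])
    (h2 : 2 ^ c ≡ 1 [MOD Q])
    (hn : n + 1 = 2 ^ k) (hx : 0 < x) (hy : 0 < y) (hz : 0 < z) (hw : 0 < w)
    (heq : n ^ x + (n + 1) ^ y + (n + 2) ^ z = (n + 3) ^ w) :
    ((2 ^ (k % c) - 1) ^ ((x - 1) % c + 1) + (2 ^ (k % c)) ^ ((y - 1) % c + 1)
      + (2 ^ (k % c) + 1) ^ ((z - 1) % c + 1)) % Q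
      = (2 ^ (k % c) + 2) ^ ((w - 1) % c + 1) % Q := by
  have hk : 2 ^ k ≡ 2 ^ (k % c) [MOD Q] := by
    conv_lhs => rw [← Nat.div_add_mod k c, pow_add, pow_mul]
    simpa using (h2.pow (k / c)).mul_right (2 ^ (k % c))
  obtain ⟨m, hm⟩ : ∃ m, 2 ^ (k % c) = m + 1 :=
    ⟨2 ^ (k % c) - 1, by have : 0 < 2 ^ (k % c) := by positivity
                         omega⟩
  rw [← hn, hm] at hk
  rw [hm]
  have h0 : n ≡ m [MOD Q] := Nat.ModEq.add_right_cancel' 1 hk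
  have e1 : m + 1 - 1 = m := by omega
  rw [e1]
  have f (b d e : ℕ) (hbd : b ≡ d [MOD Q]) (he : 0 < e) :
      b ^ e ≡ d ^ ((e - 1) % c + 1) [MOD Q] :=
    (hbd.pow e).trans (red_exp Q c d e (hQ d) he)
  have g := (((f n m x h0 hx).add (f _ _ y (h0.add_right 1) hy)).add
    (f _ _ z (h0.add_right 2) hz)).symm
  rw [heq] at g
  exact g.trans (f _ _ w (h0.add_right 3) hw)

/-- Bounded universal quantifier as a boolean. -/
def allLt (n : ℕ) (f : ℕ → Bool) : Bool := (List.range n).all f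

/-- Implication as a boolean, evaluated lazily. -/
def guardB (b c : Bool) : Bool := cond b c true

lemma allLt_spec {n : ℕ} {f : ℕ → Bool} (h : allLt n f = true) (i : ℕ) (hi : i < n) :
    f i = true := by
  unfold allLt at h
  rw [List.all_eq_true] at h
  exact h i (List.mem_range.2 hi)

lemma guardB_spec {p : Prop} [Decidable p] {c : Bool} (h : guardB (decide p) c = true)
    (hp : p) : c = true := by
  simpa [guardB, hp] using h

/-- Boolean form of the sieve modulo 12. -/
lemma sieve12B : (allLt 12 fun k => guardB (decide (k % 2 = 0)) <|
    allLt 12 fun x => guardB (decide (x % 4 = k % 4)) <|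
    guardB (decide (k % 3 = 0 → x % 3 = 0)) <|
    allLt 12 fun z => guardB (decide ((x + z + 2) % 4 = 0)) <|
    allLt 12 fun y => guardB (decide (y % 2 = 0)) <|
    guardB (decide (((2 ^ k) ^ (y + 1) + (2 ^ k + 1) ^ (z + 1)) % 9 = 0)) <|
    allLt 12 fun w => guardB (decide (
    ((2 ^ k - 1) ^ (x + 1) + (2 ^ k) ^ (y + 1) + (2 ^ k + 1) ^ (z + 1)) % 455
      = (2 ^ k + 2) ^ (w + 1) % 455)) <|
    decide ((k = 0 ∧ x = 0 ∧ z = 2 ∧ w = 1) ∨ (k = 2 ∧ x = 2 ∧ z = 0 ∧ w = 1) ∨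
    (k = 2 ∧ x = 2 ∧ z = 8 ∧ w = 8) ∨ (k = 6 ∧ x = 6 ∧ z = 8 ∧ w % 6 = 1))) = true := by
  decide +kernel

/-- Sieve modulo 12; the exponents are `x+1` etc. -/
lemma sieve12 (k : ℕ) (hk : k < 12) (hk2 : k % 2 = 0) (x : ℕ) (hx : x < 12)
    (hx4 : x % 4 = k % 4) (hx3 : k % 3 = 0 → x % 3 = 0)
    (z : ℕ) (hz : z < 12) (hxz : (x + z + 2) % 4 = 0) (y : ℕ) (hy : y < 12) (hy2 : y % 2 = 0)
    (h9 : ((2 ^ k) ^ (y + 1) + (2 ^ k + 1) ^ (z + 1)) % 9 = 0) (w : ℕ) (hw : w < 12)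
    (h : ((2 ^ k - 1) ^ (x + 1) + (2 ^ k) ^ (y + 1) + (2 ^ k + 1) ^ (z + 1)) % 455
      = (2 ^ k + 2) ^ (w + 1) % 455) :
    (k = 0 ∧ x = 0 ∧ z = 2 ∧ w = 1) ∨ (k = 2 ∧ x = 2 ∧ z = 0 ∧ w = 1) ∨
    (k = 2 ∧ x = 2 ∧ z = 8 ∧ w = 8) ∨ (k = 6 ∧ x = 6 ∧ z = 8 ∧ w % 6 = 1) := by
  have h1 := guardB_spec (allLt_spec sieve12B k hk) hk2
  have h2 := guardB_spec (guardB_spec (allLt_spec h1 x hx) hx4) hx3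
  have h3 := guardB_spec (allLt_spec h2 z hz) hxz
  have h4 := guardB_spec (guardB_spec (allLt_spec h3 y hy) hy2) h9
  exact of_decide_eq_true (guardB_spec (allLt_spec h4 w hw) h)

/-- Boolean form of the sieve modulo 36 on the surviving classes. -/
lemma sieve36B : (allLt 36 fun k => guardB (decide (k % 12 = 0 ∨ k % 12 = 2 ∨ k % 12 = 6)) <|
    allLt 36 fun x => guardB (decide (x % 12 = k % 12)) <|
    guardB (decide (k % 9 = 0 → x % 9 = 0)) <|
    allLt 36 fun z => guardB (decide (z % 12 = 2 ∧ k % 12 = 0 ∨ z % 12 = 0 ∧ k % 12 = 2 ∨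
      z % 12 = 8 ∧ (k % 12 = 2 ∨ k % 12 = 6))) <|
    allLt 36 fun y => guardB (decide (y % 2 = 0)) <|
    guardB (decide (((2 ^ k) ^ (y + 1) + (2 ^ k + 1) ^ (z + 1)) % 27 = 0)) <|
    allLt 36 fun w => guardB (decide (
    (w % 12 = 1 ∧ k % 12 = 0) ∨ (w % 12 = 1 ∧ k % 12 = 2 ∧ z % 12 = 0) ∨
      (w % 12 = 8 ∧ k % 12 = 2 ∧ z % 12 = 8) ∨ (w % 6 = 1 ∧ k % 12 = 6))) <|
    decide (((2 ^ k - 1) ^ (x + 1) + (2 ^ k) ^ (y + 1) + (2 ^ k + 1) ^ (z + 1)) % 703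
      ≠ (2 ^ k + 2) ^ (w + 1) % 703)) = true := by
  decide +kernel

/-- Sieve modulo 36 on the surviving classes. -/
lemma sieve36 (k : ℕ) (hk : k < 36) (hkc : k % 12 = 0 ∨ k % 12 = 2 ∨ k % 12 = 6)
    (x : ℕ) (hx : x < 36) (hxc : x % 12 = k % 12) (hx9 : k % 9 = 0 → x % 9 = 0)
    (z : ℕ) (hz : z < 36) (hzc : z % 12 = 2 ∧ k % 12 = 0 ∨ z % 12 = 0 ∧ k % 12 = 2 ∨
      z % 12 = 8 ∧ (k % 12 = 2 ∨ k % 12 = 6))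
    (y : ℕ) (hy : y < 36) (hy2 : y % 2 = 0)
    (h27 : ((2 ^ k) ^ (y + 1) + (2 ^ k + 1) ^ (z + 1)) % 27 = 0) (w : ℕ) (hw : w < 36)
    (hwc : (w % 12 = 1 ∧ k % 12 = 0) ∨ (w % 12 = 1 ∧ k % 12 = 2 ∧ z % 12 = 0) ∨
      (w % 12 = 8 ∧ k % 12 = 2 ∧ z % 12 = 8) ∨ (w % 6 = 1 ∧ k % 12 = 6)) :
    ((2 ^ k - 1) ^ (x + 1) + (2 ^ k) ^ (y + 1) + (2 ^ k + 1) ^ (z + 1)) % 703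
      ≠ (2 ^ k + 2) ^ (w + 1) % 703 := by
  have h1 := guardB_spec (allLt_spec sieve36B k hk) hkc
  have h2 := guardB_spec (guardB_spec (allLt_spec h1 x hx) hxc) hx9
  have h3 := guardB_spec (allLt_spec h2 z hz) hzc
  have h4 := guardB_spec (guardB_spec (allLt_spec h3 y hy) hy2) h27
  exact of_decide_eq_true (guardB_spec (allLt_spec h4 w hw) hwc)

lemma fermat27 (b : ℕ) (h : b % 3 ≠ 0) : b ^ 36 ≡ 1 [MOD 27] := by
  have h1 : ∀ r < 27, r % 3 ≠ 0 → r ^ 36 % 27 = 1 := by decide +kernel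
  have := h1 (b % 27) (Nat.mod_lt _ (by norm_num)) (by omega)
  unfold Nat.ModEq
  rw [Nat.pow_mod]; exact this

set_option maxHeartbeats 1000000 in
/-- The local contradiction. -/
lemma local_contra (k n x y z w : ℕ) (hk2 : k % 2 = 0)
    (hn : n + 1 = 2 ^ k) (hx : 3 ≤ x) (hy : y % 2 = 1) (hz : 0 < z) (hw : 3 ≤ w)
    (hx4 : (x - 1) % 4 = k % 4) (hx3 : k % 3 = 0 → (x - 1) % 3 = 0)
    (hx9 : k % 9 = 0 → (x - 1) % 9 = 0)
    (hxz : (x + z) % 4 = 0)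
    (heq : n ^ x + (n + 1) ^ y + (n + 2) ^ z = (n + 3) ^ w) : False := by
  have hn3 : n % 3 = 0 := by
    obtain ⟨j, hj⟩ : ∃ j, k = 2 * j := ⟨k / 2, by omega⟩
    have h4 : (2 ^ k) % 3 = 1 := by
      rw [hj, pow_mul, Nat.pow_mod]; norm_num
    omega
  have h27 : 27 ∣ (n + 1) ^ y + (n + 2) ^ z := by
    have a1 : 27 ∣ n ^ x :=
      (show 27 ∣ n ^ 3 from by
        obtain ⟨t, ht⟩ := Nat.dvd_of_mod_eq_zero hn3
        exact ⟨t ^ 3, by rw [ht]; ring⟩).trans (pow_dvd_pow n hx)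
    have a2 : 27 ∣ (n + 3) ^ w :=
      (show 27 ∣ (n + 3) ^ 3 from by
        obtain ⟨t, ht⟩ := Nat.dvd_of_mod_eq_zero hn3
        exact ⟨(t + 1) ^ 3, by rw [ht]; ring⟩).trans (pow_dvd_pow _ hw)
    rw [← heq, add_assoc] at a2
    exact (Nat.dvd_add_right a1).1 a2
  have h27' : ((2 ^ (k % 36)) ^ ((y - 1) % 36 + 1) +
      (2 ^ (k % 36) + 1) ^ ((z - 1) % 36 + 1)) % 27 = 0 := by
    have hk : 2 ^ k ≡ 2 ^ (k % 36) [MOD 27] := by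
      conv_lhs => rw [← Nat.div_add_mod k 36, pow_add, pow_mul]
      simpa using ((show 2 ^ 36 ≡ 1 [MOD 27] from by decide).pow (k / 36)).mul_right (2 ^ (k % 36))
    rw [← hn] at hk
    have f (b d e : ℕ) (hb : b % 3 ≠ 0) (hbd : b ≡ d [MOD 27]) (he : 0 < e) :
        b ^ e ≡ d ^ ((e - 1) % 36 + 1) [MOD 27] := by
      refine (red_exp 27 36 b e ?_ he).trans (hbd.pow _)
      rw [pow_succ]
      simpa using (fermat27 b hb).mul_right b
    have := (f _ _ y (by omega) hk (by omega)).add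
      (f (n + 2) _ z (by omega) (hk.add_right 1) hz)
    have h0 := (Nat.modEq_zero_iff_dvd).2 h27
    exact this.symm.trans h0
  have h9' : ((2 ^ (k % 12)) ^ ((y - 1) % 12 + 1) +
      (2 ^ (k % 12) + 1) ^ ((z - 1) % 12 + 1)) % 9 = 0 := by
    have hk : 2 ^ k ≡ 2 ^ (k % 12) [MOD 9] := by
      conv_lhs => rw [← Nat.div_add_mod k 12, pow_add, pow_mul]
      simpa using ((show 2 ^ 12 ≡ 1 [MOD 9] from by decide).pow (k / 12)).mul_right (2 ^ (k % 12))
    rw [← hn] at hk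
    have f9 (b : ℕ) (h : b % 3 ≠ 0) : b ^ 12 ≡ 1 [MOD 9] := by
      have h1 : ∀ r < 9, r % 3 ≠ 0 → r ^ 12 % 9 = 1 := by decide +kernel
      have := h1 (b % 9) (Nat.mod_lt _ (by norm_num)) (by omega)
      unfold Nat.ModEq
      rw [Nat.pow_mod]; exact this
    have f (b d e : ℕ) (hb : b % 3 ≠ 0) (hbd : b ≡ d [MOD 9]) (he : 0 < e) :
        b ^ e ≡ d ^ ((e - 1) % 12 + 1) [MOD 9] := by
      refine (red_exp 9 12 b e ?_ he).trans (hbd.pow _)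
      rw [pow_succ]
      simpa using (f9 b hb).mul_right b
    have := (f _ _ y (by omega) hk (by omega)).add
      (f (n + 2) _ z (by omega) (hk.add_right 1) hz)
    have h0 := (Nat.modEq_zero_iff_dvd).2 (Dvd.dvd.trans (by norm_num : 9 ∣ 27) h27)
    exact this.symm.trans h0
  have A := red_eq 455 12 k n x y z w fermat455 (by decide) hn (by omega) (by omega) hz
    (by omega) heq
  have B := red_eq 703 36 k n x y z w fermat703 (by decide) hn (by omega) (by omega) hz
    (by omega) heq
  have C := sieve12 (k % 12) (by omega) (by omega) ((x - 1) % 12) (by omega) (by omega) (by omega)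
    ((z - 1) % 12) (by omega) (by omega) ((y - 1) % 12) (by omega) (by omega) h9'
    ((w - 1) % 12) (by omega) A
  refine sieve36 (k % 36) (by omega) (by omega) ((x - 1) % 36) (by omega) (by omega) (by omega)
    ((z - 1) % 36) (by omega) (by omega) ((y - 1) % 36) (by omega) (by omega) h27'
    ((w - 1) % 36) (by omega) (by omega) B

/-- The two-adic expansion. -/
lemma two_adic (n x z : ℕ) (hx : x % 2 = 1) :
    ∃ t : ℤ, (n : ℤ) ^ x + (n + 2) ^ z = (x + z) * (n + 1) + (n + 1) ^ 2 * t := by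
  obtain ⟨a, ha⟩ := binom_two (-(n + 1 : ℤ)) x
  obtain ⟨b, hb⟩ := binom_two (n + 1 : ℤ) z
  have e1 : (1 + -(n + 1 : ℤ)) ^ x = - (n : ℤ) ^ x := by
    rw [← (Nat.odd_iff.2 hx).neg_pow]; congr 1; ring
  have e2 : (1 + (n + 1 : ℤ)) = n + 2 := by ring
  rw [e1] at ha
  rw [e2] at hb
  exact ⟨b - a, by linear_combination hb - ha⟩

theorem main_theorem (n x y z w : ℕ) (hn : 0 < n) (hn4 : n % 4 = 3)
    (hx : 0 < x) (hy : 0 < y) (hz : 0 < z) (hw : 0 < w)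
    (heq : n ^ x + (n + 1) ^ y + (n + 2) ^ z = (n + 3) ^ w) :
    n = 3 ∧ ((x, y, z, w) = (3, 1, 1, 2) ∨ (x, y, z, w) = (3, 3, 3, 3)) := by
  have hw2 : 2 ≤ w := by
    by_contra h
    have : w = 1 := by omega
    subst this
    have a1 : n + 1 ≤ (n + 1) ^ y := Nat.le_self_pow (by omega) _
    have a2 : n + 2 ≤ (n + 2) ^ z := Nat.le_self_pow (by omega) _
    rw [pow_one] at heq
    omega
  have hZ : (n : ℤ) ^ x + (n + 1) ^ y + (n + 2) ^ z = (n + 3) ^ w := by exact_mod_cast heq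
  -- x is odd
  have hxo : x % 2 = 1 := by
    by_contra h
    have hxe : Even x := Nat.even_iff.2 (by omega)
    have b1 : (4 : ℤ) ∣ n ^ x - 1 := by
      have := sub_dvd_pow_sub_pow (n : ℤ) (-1) x
      rw [hxe.neg_one_pow] at this
      exact Dvd.dvd.trans (by omega) this
    have b2 : (4 : ℤ) ∣ (n + 1) ^ y := Dvd.dvd.trans (by omega) (dvd_pow_self (n + 1 : ℤ) (by omega : y ≠ 0))
    have b3 : (4 : ℤ) ∣ (n + 2) ^ z - 1 := by
      have := sub_dvd_pow_sub_pow (n + 2 : ℤ) 1 z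
      rw [one_pow] at this
      exact Dvd.dvd.trans (by omega) this
    have b4 : (4 : ℤ) ∣ (n + 3) ^ w := by
      refine Dvd.dvd.trans ?_ (pow_dvd_pow (n + 3 : ℤ) hw2)
      have : (2 : ℤ) ∣ n + 3 := by omega
      simpa using pow_dvd_pow_of_dvd this 2
    omega
  have hxodd : Odd x := Nat.odd_iff.2 hxo
  -- n + 1 is a power of two
  obtain ⟨k, hkn⟩ : ∃ k, n + 1 = 2 ^ k := by
    have c1 : (n + 1 : ℤ) ∣ n ^ x + 1 := by
      have := sub_dvd_pow_sub_pow (n : ℤ) (-1) x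
      rw [hxodd.neg_one_pow] at this
      simpa using this
    have c2 : (n + 1 : ℤ) ∣ (n + 1) ^ y := dvd_pow_self _ (by omega)
    have c3 : (n + 1 : ℤ) ∣ (n + 2) ^ z - 1 := by
      have := sub_dvd_pow_sub_pow (n + 2 : ℤ) 1 z
      rw [one_pow] at this
      exact dvd_conv this (by ring) (by ring)
    have c4 : (n + 1 : ℤ) ∣ (n + 3) ^ w - 2 ^ w := by
      have := sub_dvd_pow_sub_pow (n + 3 : ℤ) 2 w
      exact dvd_conv this (by ring) (by ring)
    have c5 : (n + 1 : ℤ) ∣ 2 ^ w := by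
      have := dvd_sub (dvd_add (dvd_add c1 c2) c3) c4
      exact dvd_conv this (by ring) (by linarith)
    have c6 : n + 1 ∣ 2 ^ w := by exact_mod_cast c5
    obtain ⟨k, _, hk⟩ := (Nat.dvd_prime_pow Nat.prime_two).1 c6
    exact ⟨k, hk⟩
  have hk2 : 2 ≤ k := by
    by_contra h
    have : k = 0 ∨ k = 1 := by omega
    rcases this with rfl | rfl <;> omega
  have hkZ : (n + 1 : ℤ) = 2 ^ k := by exact_mod_cast hkn
  have d1 : (n + 2 : ℤ) ∣ n ^ x + 2 ^ x := by
    have := sub_dvd_pow_sub_pow (n : ℤ) (-2) x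
    rw [hxodd.neg_pow] at this
    simpa using this
  have d2 : (n + 2 : ℤ) ∣ (n + 1) ^ y - (-1) ^ y := by
    have := sub_dvd_pow_sub_pow (n + 1 : ℤ) (-1) y
    exact dvd_conv this (by ring) (by ring)
  have d3 : (n + 2 : ℤ) ∣ (n + 2) ^ z := dvd_pow_self _ (by omega)
  have d4 : (n + 2 : ℤ) ∣ (n + 3) ^ w - 1 := by
    have := sub_dvd_pow_sub_pow (n + 3 : ℤ) 1 w
    rw [one_pow] at this
    exact dvd_conv this (by ring) (by ring)
  have d5 : (n + 2 : ℤ) ∣ 2 ^ x - (-1) ^ y + 1 := by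
    have := dvd_sub (dvd_add (dvd_add d1 d2) d3) d4
    exact dvd_conv this (by ring) (by linarith)
  have hcop : IsCoprime (n + 2 : ℤ) 2 := by
    obtain ⟨t, ht⟩ : ∃ t : ℤ, (n : ℤ) = 2 * t + 1 := ⟨(n : ℤ) / 2, by omega⟩
    exact ⟨1, -(t + 1), by rw [ht]; ring⟩
  have hyo : y % 2 = 1 := by
    by_contra h
    have hye : Even y := Nat.even_iff.2 (by omega)
    rw [hye.neg_one_pow] at d5
    have d6 : (n + 2 : ℤ) ∣ 2 ^ x := by simpa using d5
    have := (hcop.pow_right (n := x)).isUnit_of_dvd' dvd_rfl d6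
    rw [Int.isUnit_iff] at this
    omega
  have d6 : (2 ^ k + 1 : ℤ) ∣ 2 ^ (x - 1) + 1 := by
    rw [(Nat.odd_iff.2 hyo).neg_one_pow] at d5
    have e : (2 : ℤ) ^ x - -1 + 1 = 2 * (2 ^ (x - 1) + 1) := by
      conv_lhs => rw [show x = (x - 1) + 1 by omega]
      rw [pow_succ]; ring
    rw [e] at d5
    have := hcop.dvd_of_dvd_mul_left d5
    rw [← hkZ]
    exact dvd_conv this (by ring) (by ring)
  obtain ⟨a, ha, hxa⟩ := ord_two k (x - 1) (by omega) d6
  obtain ⟨c, hc⟩ : ∃ c, a = 2 * c + 1 := ⟨a / 2, by omega⟩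
  have hke : k % 2 = 0 := by
    by_contra h
    have : Odd (k * a) := (Nat.odd_iff.2 (by omega)).mul (Nat.odd_iff.2 ha)
    rw [← hxa, Nat.odd_iff] at this
    omega
  have hxk : k + 1 ≤ x := by
    have : k * 1 ≤ k * a := Nat.mul_le_mul_left _ (by omega)
    omega
  have hx4 : (x - 1) % 4 = k % 4 := by
    obtain ⟨j, hj⟩ : ∃ j, k = 2 * j := ⟨k / 2, by omega⟩
    have : x - 1 = k + 4 * (j * c) := by rw [hxa, hc, hj]; ring
    omega
  have hxd : ∀ d, k % d = 0 → (x - 1) % d = 0 := by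
    intro d hd
    rw [hxa]
    exact Nat.mod_eq_zero_of_dvd (Dvd.dvd.mul_right (Nat.dvd_of_mod_eq_zero hd) _)
  -- z is odd
  have hn3 : n % 3 = 0 := by
    obtain ⟨j, hj⟩ : ∃ j, k = 2 * j := ⟨k / 2, by omega⟩
    have h4 : (2 ^ k) % 3 = 1 := by
      rw [hj, pow_mul, Nat.pow_mod]; norm_num
    omega
  have hzo : z % 2 = 1 := by
    by_contra h
    have hze : Even z := Nat.even_iff.2 (by omega)
    have b1 : (3 : ℤ) ∣ n ^ x := Dvd.dvd.trans (by omega) (dvd_pow_self (n : ℤ) (by omega : x ≠ 0))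
    have b2 : (3 : ℤ) ∣ (n + 1) ^ y - 1 := by
      have := sub_dvd_pow_sub_pow (n + 1 : ℤ) 1 y
      rw [one_pow] at this
      exact Dvd.dvd.trans (by omega) this
    have b3 : (3 : ℤ) ∣ (n + 2) ^ z - 1 := by
      have := sub_dvd_pow_sub_pow (n + 2 : ℤ) (-1) z
      rw [hze.neg_one_pow] at this
      exact Dvd.dvd.trans (by omega) this
    have b4 : (3 : ℤ) ∣ (n + 3) ^ w :=
      Dvd.dvd.trans (by omega) (dvd_pow_self (n + 3 : ℤ) (by omega : w ≠ 0))
    omega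
  obtain ⟨t, ht⟩ := two_adic n x z hxo
  have hNpos : (0 : ℤ) < 2 ^ k := by positivity
  -- for `w ≥ k + i` we get divisibility of the right side
  have hdvd : ∀ i, k + i ≤ w → (2 ^ k * 2 ^ i : ℤ) ∣ (n + 3) ^ w := by
    intro i hi
    rw [← pow_add]
    refine (pow_dvd_pow (2 : ℤ) hi).trans (pow_dvd_pow_of_dvd ?_ w)
    omega
  have hxlt : n ^ x < (n + 3) ^ w := by
    rw [← heq]
    have : 0 < (n + 1) ^ y := by positivity
    omega
  have hzlt : n ^ z < (n + 3) ^ w := by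
    rw [← heq]
    have h1 : 0 < (n + 1) ^ y := by positivity
    have h2 : n ^ z ≤ (n + 2) ^ z := Nat.pow_le_pow_left (by omega) z
    omega
  have h4N : (4 : ℤ) ∣ 2 ^ k := by simpa using pow_dvd_pow (2 : ℤ) hk2
  rcases Nat.lt_or_ge y 2 with hy1 | hy2
  · -- y = 1, so w ≤ k
    have hy1 : y = 1 := by omega
    subst hy1
    have hwk : w ≤ k := by
      by_contra h
      have h1 := hdvd 1 (by omega)
      have e : ((n : ℤ) + 3) ^ w = 2 ^ k * (x + z + 1 + 2 ^ k * t) := by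
        rw [← hZ, ← hkZ]; linear_combination ht
      rw [e] at h1
      have h2 := Int.dvd_of_mul_dvd_mul_left hNpos.ne' h1
      have h3 : (2 : ℤ) ∣ 2 ^ k * t := Dvd.dvd.mul_right (Dvd.dvd.trans (by norm_num) h4N) _
      omega
    rcases Nat.lt_or_ge k 4 with hk4 | hk4
    · have hk : k = 2 := by omega
      subst hk
      have hn3 : n = 3 := by omega
      subst hn3
      have hw' : w = 2 := by omega
      subst hw'
      refine ⟨rfl, Or.inl ?_⟩
      have hx' : x < 4 := (Nat.pow_lt_pow_iff_right (by norm_num : 1 < 3)).1 (hxlt.trans (by norm_num))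
      have hx'' : x = 3 := by omega
      subst hx''
      have h5 : 5 ^ z = 5 ^ 1 := by norm_num at heq ⊢; omega
      have : z = 1 := Nat.pow_right_injective (by norm_num : 2 ≤ 5) h5
      subst this
      rfl
    · exfalso
      have s := size_cmp k n hk4 hkn
      have s1 : n ^ (k + 1) < (n + 3) ^ k :=
        (Nat.pow_le_pow_right hn hxk).trans_lt (hxlt.trans_le (Nat.pow_le_pow_right (by omega) hwk))
      have s2 : n ^ (k + 2) ≤ (n + 3) ^ (k + 1) := by
        rw [pow_succ, pow_succ (n + 3)]
        exact Nat.mul_le_mul s1.le (by omega)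
      have s3 : n ^ (k + 2) < (n + 3) ^ (k + 1) := by
        rw [pow_succ, pow_succ (n + 3)]
        exact Nat.mul_lt_mul_of_lt_of_le s1 (by omega) (by omega)
      omega
  · obtain ⟨j, hj⟩ : ∃ j, y = 2 + j := ⟨y - 2, by omega⟩
    have e : ((n : ℤ) + 3) ^ w = 2 ^ k * (x + z + 2 ^ k * (t + (2 ^ k) ^ j)) := by
      rw [← hZ, hj, ← hkZ]; linear_combination ht
    have hwk : k + 1 ≤ w := by
      by_contra h
      -- the right side is `2^w` times an odd number
      obtain ⟨q, hq⟩ : ∃ q : ℤ, (n + 3 : ℤ) = 2 * (2 * q + 1) := ⟨((n : ℤ) + 1) / 4, by omega⟩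
      have h1 : (2 ^ k * 2 : ℤ) ∣ (n + 3) ^ w := by
        rw [e]
        refine mul_dvd_mul_left _ ?_
        have h3 : (2 : ℤ) ∣ 2 ^ k * (t + (2 ^ k) ^ j) :=
          Dvd.dvd.mul_right (Dvd.dvd.trans (by norm_num) h4N) _
        omega
      have h2 : (2 ^ w * 2 : ℤ) ∣ (n + 3) ^ w :=
        (mul_dvd_mul_right (pow_dvd_pow 2 (by omega)) 2).trans h1
      rw [hq, mul_pow] at h2
      have h3 := Int.dvd_of_mul_dvd_mul_left (by positivity) h2
      have h4 := Int.prime_two.dvd_of_dvd_pow h3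
      omega
    rcases Nat.lt_or_ge w (k + 2) with hwk2 | hwk2
    · have hw' : w = k + 1 := by omega
      subst hw'
      rcases Nat.lt_or_ge k 4 with hk4 | hk4
      · have hk : k = 2 := by omega
        subst hk
        have hn3 : n = 3 := by omega
        subst hn3
        refine ⟨rfl, Or.inr ?_⟩
        have hx' : x < 5 := (Nat.pow_lt_pow_iff_right (by norm_num : 1 < 3)).1 (hxlt.trans (by norm_num))
        have hx'' : x = 3 := by omega
        have hz' : z < 5 := (Nat.pow_lt_pow_iff_right (by norm_num : 1 < 3)).1 (hzlt.trans (by norm_num))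
        have hyl : 4 ^ y < 4 ^ 4 := by
          refine lt_of_le_of_lt ?_ (by norm_num : (3 + 3) ^ (2 + 1) < 4 ^ 4)
          rw [← heq]
          have e0 : 3 + 1 = 4 := rfl
          rw [e0]
          exact (Nat.le_add_left _ _).trans (Nat.le_add_right _ _)
        have hy' : y < 4 := (Nat.pow_lt_pow_iff_right (by norm_num : 1 < 4)).1 hyl
        have hy'' : y = 3 := by omega
        subst hx'' hy''
        have hz3 : z = 1 ∨ z = 3 := by omega
        rcases hz3 with rfl | rfl
        · norm_num at heq
        · rfl
      · exfalso
        have s := size_cmp k n hk4 hkn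
        have hn1 : 1 < n := by omega
        have hx' : x < k + 2 := (Nat.pow_lt_pow_iff_right hn1).1 (hxlt.trans_le s)
        have hz' : z < k + 2 := (Nat.pow_lt_pow_iff_right hn1).1 (hzlt.trans_le s)
        -- x + z ≡ 2 mod 2^k
        obtain ⟨q, hq⟩ : ∃ q : ℤ, (n + 3 : ℤ) = 2 * q := ⟨((n : ℤ) + 3) / 2, by omega⟩
        have e2 : (2 : ℤ) * q ^ (k + 1) = x + z + 2 ^ k * (t + (2 ^ k) ^ j) := by
          rw [hq, mul_pow, pow_succ (2 : ℤ), mul_assoc] at e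
          exact mul_left_cancel₀ hNpos.ne' e
        have e3 : (2 ^ k : ℤ) ∣ 2 * q ^ (k + 1) - 2 := by
          have h1 := sub_dvd_pow_sub_pow q 1 (k + 1)
          have h2 := mul_dvd_mul_left 2 h1
          have h3 : 2 * (q - 1) = (2 ^ k : ℤ) := by linarith
          rw [h3, one_pow] at h2
          exact dvd_conv h2 (by ring) (by ring)
        have e4 : (2 ^ k : ℤ) ∣ x + z - 2 := by
          have := dvd_sub e3 (Dvd.intro (t + (2 ^ k) ^ j) rfl : (2 ^ k : ℤ) ∣ 2 ^ k * (t + (2 ^ k) ^ j))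
          rw [e2] at this
          exact dvd_conv this (by ring) (by ring)
        have e5 := Int.le_of_dvd (by omega) e4
        have e6 : 2 * k < 2 ^ k := by
          clear * - hk4
          induction k, hk4 using Nat.le_induction with
          | base => norm_num
          | succ k hk ih => rw [pow_succ]; omega
        have e7 : (2 * k : ℤ) < 2 ^ k := by exact_mod_cast e6
        omega
    · exfalso
      have h1 := hdvd 2 hwk2
      rw [e] at h1
      have h2 := Int.dvd_of_mul_dvd_mul_left hNpos.ne' h1
      have h3 : (4 : ℤ) ∣ 2 ^ k * (t + (2 ^ k) ^ j) := Dvd.dvd.mul_right h4N _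
      refine local_contra k n x y z w hke hkn (by omega) hyo hz (by omega) hx4 (hxd 3) (hxd 9)
        (by omega) heq
end

section
/- Let e be an integer with e ≥ 9 and let (x, y, z, w) be a solution in positive integers of (4^e−1)^x + 4^{e·y} + (4^e+1)^z = (4^e+2)^w. Then y < w/2 and x < w/2. -/
theorem sum_mono_finset (ω : ℕ → ℕ) (hω : Monotone ω) (s : Finset ℕ) :
    ∑ i ∈ Finset.range s.card, ω i ≤ ∑ n ∈ s, ω n := by
  induction s using Finset.induction_on_max with
  | empty => simp
  | insert a s hs ih =>
    have ha : a ∉ s := fun h => lt_irrefl _ (hs a h)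
    rw [Finset.card_insert_of_notMem ha, Finset.sum_insert ha, Finset.sum_range_succ]
    have hc : s.card ≤ a := by
      have : s ⊆ Finset.range a := fun x hx => Finset.mem_range.2 (hs x hx)
      simpa using Finset.card_le_card this
    have := hω hc
    omega

theorem sum_mono_inj {ι : Type*} [Fintype ι] (f : ι → ℕ) (hf : Function.Injective f)
    (ω : ℕ → ℕ) (hω : Monotone ω) :
    ∑ i ∈ Finset.range (Fintype.card ι), ω i ≤ ∑ r, ω (f r) := by
  classical
  have hs : (Finset.univ.image f).card = Fintype.card ι := by
    rw [Finset.card_image_of_injective _ hf, Finset.card_univ]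
  have h1 : ∑ r, ω (f r) = ∑ n ∈ Finset.univ.image f, ω n := by
    rw [Finset.sum_image (fun x _ y _ h => hf h)]
  rw [h1, ← hs]
  exact sum_mono_finset ω hω _

/-- Divisibility of a determinant of a product of rectangular matrices. -/
theorem det_dvd {ι τ : Type*} [Fintype ι] [DecidableEq ι] [Fintype τ] (q : ℤ)
    (G : ι → τ → ℤ) (C : τ → ι → ℤ) (F : Matrix ι ι ℤ) (φ : τ → ℕ) (hφ : Function.Injective φ)
    (ω : ℕ → ℕ) (hω : Monotone ω) (hG : ∀ r t, q ^ ω (φ t) ∣ G r t)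
    (hF : ∀ r s, F r s = ∑ t, G r t * C t s) :
    q ^ (∑ i ∈ Finset.range (Fintype.card ι), ω i) ∣ F.det := by
  classical
  have h1 : F.det = ∑ f : ι → τ, (∏ r, G r (f r)) * Matrix.det (fun r s => C (f r) s) := by
    have : F = fun r => ∑ t, G r t • C t := by
      funext r s
      simp [hF, Finset.sum_apply]
    rw [this]
    have := (Matrix.detRowAlternating (n := ι) (R := ℤ)).toMultilinearMap.map_sum
      (fun r t => G r t • C t)
    refine this.trans ?_
    refine Finset.sum_congr rfl fun f _ => ?_
    have := (Matrix.detRowAlternating (n := ι) (R := ℤ)).toMultilinearMap.map_smul_univ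
      (fun r => G r (f r)) (fun r => C (f r))
    refine this.trans ?_
    rfl
  rw [h1]
  refine Finset.dvd_sum fun f _ => ?_
  by_cases hf : Function.Injective f
  · refine Dvd.dvd.mul_right ?_ _
    have h2 : (∏ r, q ^ ω (φ (f r))) ∣ ∏ r, G r (f r) :=
      Finset.prod_dvd_prod_of_dvd _ _ fun r _ => hG r _
    rw [Finset.prod_pow_eq_pow_sum] at h2
    exact (pow_dvd_pow q (sum_mono_inj (fun r => φ (f r)) (hφ.comp hf) ω hω)).trans h2
  · have : Matrix.det (fun r s => C (f r) s) = 0 := by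
      simp only [Function.Injective, not_forall] at hf
      obtain ⟨i, j, hij, hne⟩ := hf
      exact Matrix.det_zero_of_row_eq hne (by simp [hij])
    rw [this]; simp

theorem fwd_leibniz (f : ℕ → ℤ) (l : ℕ) : ∀ z : ℕ,
    (fwdDiff 1)^[l + 1] (fun z : ℕ => (z : ℤ) * f z) z
      = z * (fwdDiff 1)^[l + 1] f z + (l + 1) * (fwdDiff 1)^[l] f (z + 1) := by
  induction l with
  | zero => intro z; simp [fwdDiff]; ring
  | succ l ih =>
    intro z
    rw [Function.iterate_succ_apply' (fwdDiff 1) (l + 1) (fun z : ℕ => (z : ℤ) * f z),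
      Function.iterate_succ_apply' (fwdDiff 1) (l + 1) f]
    simp only [fwdDiff]
    rw [ih, ih]
    have h : (fwdDiff 1)^[l + 1] f (z + 1)
        = (fwdDiff 1)^[l] f (z + 1 + 1) - (fwdDiff 1)^[l] f (z + 1) := by
      rw [Function.iterate_succ_apply']; rfl
    push_cast
    linear_combination (-(l : ℤ) - 1) * h

theorem fwd_pow (c : ℤ) (l : ℕ) : ∀ z : ℕ,
    (fwdDiff 1)^[l] (fun z : ℕ => c ^ z) z = (c - 1) ^ l * c ^ z := by
  induction l with
  | zero => intro z; simp
  | succ l ih =>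
    intro z
    rw [Function.iterate_succ_apply']
    simp only [fwdDiff]
    rw [ih, ih]; ring

theorem fwd_dvd (q c : ℤ) (hc : q ∣ c - 1) (u : ℕ) : ∀ l z : ℕ,
    q ^ (l - u) ∣ (fwdDiff 1)^[l] (fun z : ℕ => (z : ℤ) ^ u * c ^ z) z := by
  induction u with
  | zero =>
    intro l z
    simp only [pow_zero, one_mul, Nat.sub_zero, fwd_pow]
    exact Dvd.dvd.mul_right (pow_dvd_pow_of_dvd hc l) _
  | succ u ih =>
    intro l z
    cases l with
    | zero => simp
    | succ l =>
      have : (fun z : ℕ => (z : ℤ) ^ (u + 1) * c ^ z)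
          = fun z : ℕ => (z : ℤ) * ((fun z : ℕ => (z : ℤ) ^ u * c ^ z) z) := by
        funext z; ring
      rw [this, fwd_leibniz]
      have h1 := ih (l + 1) z
      have h2 := ih l (z + 1)
      rw [Nat.add_sub_add_right]
      exact dvd_add (Dvd.dvd.mul_left ((pow_dvd_pow q (by omega)).trans h1) _)
        (Dvd.dvd.mul_left h2 _)

/-- Newton expansion with divisible coefficients. -/
theorem newton_expand (q c : ℤ) (hc : q ∣ c - 1) (u T : ℕ) : ∃ g : Fin T → ℤ,
    (∀ l : Fin T, q ^ ((l : ℕ) - u) ∣ g l) ∧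
    ∀ z : ℕ, z < T → (z : ℤ) ^ u * c ^ z = ∑ l : Fin T, g l * (z.choose l : ℤ) := by
  refine ⟨fun l => (fwdDiff 1)^[(l : ℕ)] (fun z : ℕ => (z : ℤ) ^ u * c ^ z) 0,
    fun l => fwd_dvd q c hc u l 0, fun z hz => ?_⟩
  have h := shift_eq_sum_fwdDiff_iter 1 (fun z : ℕ => (z : ℤ) ^ u * c ^ z) z 0
  simp only [smul_eq_mul, mul_one, zero_add, nsmul_eq_mul] at h
  rw [h,
    Fin.sum_univ_eq_sum_range (fun k =>
    (fwdDiff 1)^[k] (fun z : ℕ => (z : ℤ) ^ u * c ^ z) 0 * (z.choose k : ℤ)) T]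
  rw [← Finset.sum_subset (Finset.range_subset_range.2 (Nat.succ_le_of_lt hz))]
  · exact Finset.sum_congr rfl fun _ _ => mul_comm _ _
  · intro k _ hk
    rw [Nat.choose_eq_zero_of_lt (by simpa using hk)]
    simp

/-- The interpolation determinant is highly divisible. -/
theorem interp_det_dvd (q : ℤ) (K L V : ℕ) (c : ℤ) (hc : q ∣ c - 1) (Z : Fin K × Fin L → ℕ)
    (Y : Fin K × Fin L → ℤ) (hY : ∀ s, q ^ V ∣ Y s - c ^ Z s) (hV : K * L ≤ V) :
    q ^ (∑ i ∈ Finset.range (K * L), (i - K)) ∣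
      Matrix.det (Matrix.of fun r s : Fin K × Fin L => (Z s : ℤ) ^ (r.1 : ℕ) * Y s ^ (r.2 : ℕ)) := by
  classical
  obtain ⟨T, hT⟩ : ∃ T, ∀ s, Z s < T := by
    refine ⟨(∑ s, Z s) + 1, fun s => ?_⟩
    have := Finset.single_le_sum (f := Z) (fun _ _ => Nat.zero_le _) (Finset.mem_univ s)
    omega
  have hex : ∀ r : Fin K × Fin L, _ := fun r =>
    newton_expand q (c ^ (r.2 : ℕ)) (hc.trans (by simpa using sub_dvd_pow_sub_pow c 1 (r.2 : ℕ)))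
      (r.1 : ℕ) T
  choose g hg1 hg2 using hex
  have hH : ∀ r s : Fin K × Fin L, ∃ H : ℤ, (Z s : ℤ) ^ (r.1 : ℕ) * Y s ^ (r.2 : ℕ)
      = (Z s : ℤ) ^ (r.1 : ℕ) * (c ^ (r.2 : ℕ)) ^ Z s + q ^ V * H := by
    intro r s
    obtain ⟨d, hd⟩ := (hY s).trans (sub_dvd_pow_sub_pow (Y s) (c ^ Z s) (r.2 : ℕ))
    refine ⟨(Z s : ℤ) ^ (r.1 : ℕ) * d, ?_⟩
    rw [← pow_mul, mul_comm (r.2 : ℕ) (Z s), pow_mul]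
    linear_combination (Z s : ℤ) ^ (r.1 : ℕ) * hd
  choose H hH using hH
  have key := det_dvd q (ι := Fin K × Fin L) (τ := Fin T ⊕ (Fin K × Fin L))
    (fun r t => Sum.elim (fun l => g r l) (fun r' => if r = r' then q ^ V else 0) t)
    (fun t s => Sum.elim (fun l : Fin T => ((Z s).choose l : ℤ)) (fun r' => H r' s) t)
    (Matrix.of fun r s : Fin K × Fin L => (Z s : ℤ) ^ (r.1 : ℕ) * Y s ^ (r.2 : ℕ))
    (Sum.elim (fun l : Fin T => (l : ℕ)) (fun r => T + (Fintype.equivFin _ r : ℕ)))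
    (by
      rintro (x | x) (y | y) h
      · simp only [Sum.elim_inl] at h; rw [Fin.ext h]
      · simp only [Sum.elim_inl, Sum.elim_inr] at h; have := x.2; omega
      · simp only [Sum.elim_inl, Sum.elim_inr] at h; have := y.2; omega
      · simp only [Sum.elim_inr, Nat.add_left_cancel_iff] at h
        rw [(Fintype.equivFin _).injective (Fin.ext h)])
    (fun i => min (i - K) V)
    (by intro i j hij; exact min_le_min (by omega) le_rfl)
    (by
      rintro r (l | r')
      · simp only [Sum.elim_inl]
        refine (pow_dvd_pow q ?_).trans (hg1 r l)
        have := r.1.2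
        exact (min_le_left _ _).trans (by omega)
      · simp only [Sum.elim_inr]
        split_ifs
        · exact pow_dvd_pow q (min_le_right _ _)
        · exact dvd_zero _)
    (by
      intro r s
      simp only [Matrix.of_apply, Fintype.sum_sum_type, Sum.elim_inl, Sum.elim_inr, ite_mul,
        zero_mul, Finset.sum_ite_eq, Finset.mem_univ, if_true]
      rw [hH, hg2 r (Z s) (hT s)])
  have hcard : Fintype.card (Fin K × Fin L) = K * L := by simp
  rw [hcard] at key
  convert key using 2
  refine Finset.sum_congr rfl fun i hi => ?_
  have := Finset.mem_range.1 hi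
  exact (min_eq_left (by omega)).symm

open Polynomial in
theorem coeff_prod_le {ι : Type*} (s : Finset ι) (f : ι → ℤ[X]) (d : ι → ℕ)
    (h : ∀ i ∈ s, (f i).natDegree ≤ d i) :
    (∏ i ∈ s, f i).natDegree ≤ ∑ i ∈ s, d i ∧
    (∏ i ∈ s, f i).coeff (∑ i ∈ s, d i) = ∏ i ∈ s, (f i).coeff (d i) := by
  classical
  induction s using Finset.induction_on with
  | empty => simp
  | insert a s ha ih =>
    obtain ⟨h1, h2⟩ := ih fun i hi => h i (Finset.mem_insert_of_mem hi)
    have h3 := h a (Finset.mem_insert_self _ _)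
    rw [Finset.prod_insert ha, Finset.sum_insert ha, Finset.prod_insert ha]
    refine ⟨natDegree_mul_le.trans (add_le_add h3 h1), ?_⟩
    rw [coeff_mul_add_eq_of_natDegree_le h3 h1, h2]

open Polynomial in
theorem det_poly {ι : Type*} [Fintype ι] [DecidableEq ι] (A : Matrix ι ι ℤ[X]) (d : ι → ℕ)
    (h : ∀ s v, (A s v).natDegree ≤ d v) :
    A.det.natDegree ≤ ∑ v, d v ∧
    A.det.coeff (∑ v, d v) = Matrix.det (Matrix.of fun s v => (A s v).coeff (d v)) := by
  rw [Matrix.det_apply, Matrix.det_apply]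
  constructor
  · refine natDegree_sum_le_of_forall_le _ _ fun σ _ => ?_
    refine (natDegree_smul_le _ _).trans ?_
    exact (coeff_prod_le _ (fun i => A (σ i) i) d fun i _ => h _ _).1
  · rw [finsetSum_coeff]
    refine Finset.sum_congr rfl fun σ _ => ?_
    have := (coeff_prod_le Finset.univ (fun i => A (σ i) i) d fun i _ => h _ _).2
    rw [Units.smul_def, Units.smul_def, coeff_smul, this]
    rfl

open Polynomial in
/-- Zero estimate. -/
theorem zero_estimate (a b : ℤ) (ha : a ≠ 0) (hb : b ≠ 0) (m n K L I₁ I₂ : ℕ) (hK : 0 < K)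
    (hab : ∀ i j i' j' : ℕ, a ^ i * b ^ j = a ^ i' * b ^ j' → i = i' ∧ j = j')
    (hL : L ≤ I₁ * I₁)
    (hz : ∀ i j i' j' : ℕ, i < I₂ → j < I₂ → i' < I₂ → j' < I₂ →
      i * n + j * m = i' * n + j' * m → i = i' ∧ j = j')
    (hI₂ : (K - 1) * L < I₂ * I₂) (c : Fin K × Fin L → ℤ)
    (hvan : ∀ i j : ℕ, i < I₁ + I₂ → j < I₁ + I₂ →
      ∑ r, c r * (((i * n + j * m : ℕ) : ℤ) ^ (r.1 : ℕ) * (a ^ i * b ^ j) ^ (r.2 : ℕ)) = 0) :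
    c = 0 := by
  classical
  by_contra hc
  set Q : Fin L → ℤ[X] := fun v => ∑ u : Fin K, C (c (u, v)) * X ^ (u : ℕ) with hQ
  set Qt : Fin L → ℤ[X] := fun v => if Q v = 0 then 1 else Q v with hQt
  have hQt0 : ∀ v, Qt v ≠ 0 := by
    intro v; simp only [hQt]; split_ifs with h
    · exact one_ne_zero
    · exact h
  have hdeg : ∀ v, (Qt v).natDegree ≤ K - 1 := by
    intro v; simp only [hQt]; split_ifs with h
    · simp
    · refine natDegree_sum_le_of_forall_le _ _ fun u _ => ?_
      refine (natDegree_C_mul_X_pow_le _ _).trans ?_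
      have := u.2; omega
  set si : Fin L → ℕ := fun s => (s : ℕ) / I₁
  set sj : Fin L → ℕ := fun s => (s : ℕ) % I₁
  have hsi : ∀ s, si s < I₁ := fun s => Nat.div_lt_of_lt_mul (s.2.trans_le hL)
  have hI₁ : ∀ _ : Fin L, 0 < I₁ := fun s => (Nat.zero_le _).trans_lt (hsi s)
  have hsj : ∀ s, sj s < I₁ := fun s => Nat.mod_lt _ (hI₁ s)
  set y : Fin L → ℤ := fun s => a ^ si s * b ^ sj s with hy
  have hyinj : Function.Injective y := by
    intro s s' h
    obtain ⟨h1, h2⟩ := hab _ _ _ _ h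
    apply Fin.ext
    rw [← Nat.div_add_mod (s : ℕ) I₁, ← Nat.div_add_mod (s' : ℕ) I₁]
    change I₁ * si s + sj s = I₁ * si s' + sj s'
    rw [h1, h2]
  set zz : Fin L → ℕ := fun s => si s * n + sj s * m with hzz
  set A : Matrix (Fin L) (Fin L) ℤ[X] :=
    Matrix.of fun s v => C (y s ^ (v : ℕ)) * (Qt v).comp (X + C (zz s : ℤ)) with hA
  have hAdeg : ∀ s v, (A s v).natDegree ≤ (Qt v).natDegree := by
    intro s v
    simp only [hA, Matrix.of_apply]
    refine (natDegree_C_mul_le _ _).trans ?_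
    rw [natDegree_comp, natDegree_X_add_C, mul_one]
  obtain ⟨hD1, hD2⟩ := det_poly A (fun v => (Qt v).natDegree) hAdeg
  have hDdeg : A.det.natDegree ≤ (K - 1) * L := by
    refine hD1.trans ((Finset.sum_le_sum fun v _ => hdeg v).trans ?_)
    simp [mul_comm]
  have hcoef : ∀ s v, (A s v).coeff ((Qt v).natDegree)
      = (Qt v).leadingCoeff * y s ^ (v : ℕ) := by
    intro s v
    simp only [hA, Matrix.of_apply, coeff_C_mul]
    have h1 : ((Qt v).comp (X + C (zz s : ℤ))).natDegree = (Qt v).natDegree := by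
      rw [natDegree_comp, natDegree_X_add_C, mul_one]
    have h2 : ((Qt v).comp (X + C (zz s : ℤ))).leadingCoeff = (Qt v).leadingCoeff := by
      rw [leadingCoeff_comp (by rw [natDegree_X_add_C]; exact one_ne_zero), leadingCoeff_X_add_C,
        one_pow, mul_one]
    rw [← h2, leadingCoeff, h1, mul_comm]
  have hDne : A.det ≠ 0 := by
    intro h0
    rw [h0, coeff_zero] at hD2
    have h3 : (Matrix.of fun s v => (A s v).coeff ((Qt v).natDegree))
        = Matrix.of fun s v => (Qt v).leadingCoeff * (Matrix.vandermonde y) s v := by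
      ext s v; simp [hcoef, Matrix.vandermonde_apply]
    rw [h3, Matrix.det_mul_row] at hD2
    rcases mul_eq_zero.1 hD2.symm with h | h
    · obtain ⟨v, _, hv⟩ := Finset.prod_eq_zero_iff.1 h
      exact hQt0 v (leadingCoeff_eq_zero.1 hv)
    · exact (Matrix.det_vandermonde_ne_zero_iff.2 hyinj) h
  apply hDne
  have hfinj : Function.Injective
      (fun t : Fin I₂ × Fin I₂ => (((t.1 : ℕ) * n + (t.2 : ℕ) * m : ℕ) : ℤ)) := by
    intro t t' h
    obtain ⟨h1, h2⟩ := hz _ _ _ _ t.1.2 t.2.2 t'.1.2 t'.2.2 (by dsimp only at h; exact_mod_cast h)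
    exact Prod.ext (Fin.ext h1) (Fin.ext h2)
  refine eq_zero_of_natDegree_lt_card_of_eval_eq_zero _ hfinj ?_ ?_
  · intro t
    obtain ⟨i, j⟩ := t
    rw [← coe_evalRingHom, RingHom.map_det]
    rw [← Matrix.exists_mulVec_eq_zero_iff]
    refine ⟨fun v => if Q v = 0 then 0 else (a ^ (i : ℕ) * b ^ (j : ℕ)) ^ (v : ℕ), ?_, ?_⟩
    · intro h0
      apply hc
      have hQ0 : ∀ v, Q v = 0 := by
        intro v
        have := congrFun h0 v
        by_contra hv
        simp only [hv, if_false, Pi.zero_apply] at this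
        exact pow_ne_zero _ (mul_ne_zero (pow_ne_zero _ ha) (pow_ne_zero _ hb)) this
      funext ⟨u, v⟩
      have := congrArg (fun p => coeff p (u : ℕ)) (hQ0 v)
      simp only [hQ, finsetSum_coeff, coeff_C_mul, coeff_X_pow, coeff_zero] at this
      rw [Finset.sum_eq_single u] at this
      · simpa using this
      · intro u' _ hne
        rw [if_neg, mul_zero]
        intro h; exact hne (Fin.ext h.symm)
      · simp
    · funext s
      simp only [Matrix.mulVec, dotProduct, Pi.zero_apply, RingHom.mapMatrix_apply,
        Matrix.map_apply, hA, Matrix.of_apply, coe_evalRingHom, eval_mul, eval_C, eval_comp,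
        eval_add, eval_X]
      have h1 := hvan (si s + i) (sj s + j) (by have := hsi s; have := i.2; omega)
        (by have := hsj s; have := j.2; omega)
      rw [Fintype.sum_prod_type_right] at h1
      refine Eq.trans ?_ h1
      refine Finset.sum_congr rfl fun v _ => ?_
      have h2 : ∀ x : ℤ, eval x (Q v) = ∑ u : Fin K, c (u, v) * x ^ (u : ℕ) := by
        intro x; simp [hQ, eval_finsetSum]
      have h3 : ∑ u : Fin K, c (u, v) * ((((si s + i) * n + (sj s + j) * m : ℕ) : ℤ) ^ (u : ℕ)
          * (a ^ (si s + i) * b ^ (sj s + j)) ^ (v : ℕ))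
          = y s ^ (v : ℕ) * eval ((((i : ℕ) * n + (j : ℕ) * m : ℕ) : ℤ) + (zz s : ℤ)) (Q v)
            * (a ^ (i : ℕ) * b ^ (j : ℕ)) ^ (v : ℕ) := by
        rw [h2, Finset.mul_sum, Finset.sum_mul]
        refine Finset.sum_congr rfl fun u _ => ?_
        have e1 : (((si s + i) * n + (sj s + j) * m : ℕ) : ℤ)
            = (((i : ℕ) * n + (j : ℕ) * m : ℕ) : ℤ) + (zz s : ℤ) := by
          simp only [hzz]; push_cast; ring
        have e2 : a ^ (si s + i) * b ^ (sj s + j) = y s * (a ^ (i : ℕ) * b ^ (j : ℕ)) := by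
          simp only [hy, pow_add]; ring
        rw [e1, e2, mul_pow]; ring
      dsimp only
      rw [h3]
      by_cases hv : Q v = 0
      · simp [hv]
      · simp only [hQt, hv, if_false]
  · simp only [Fintype.card_prod, Fintype.card_fin]
    exact hDdeg.trans_lt hI₂

/-- Extraction of a nonvanishing maximal minor. -/
theorem exists_minor {ι κ : Type*} [Fintype ι] [DecidableEq ι] [Fintype κ] (E : ι → κ → ℤ)
    (h : ∀ c : ι → ℤ, (∀ k, ∑ r, c r * E r k = 0) → c = 0) :
    ∃ f : ι → κ, Matrix.det (Matrix.of fun r s => E r (f s)) ≠ 0 := by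
  classical
  by_contra hcon
  push Not at hcon
  -- columns over the rationals
  let col : κ → (ι → ℚ) := fun k r => (E r k : ℚ)
  obtain ⟨κ', g, hg, hspan, hli⟩ := exists_linearIndependent' ℚ col
  have : Finite κ' := Finite.of_injective g hg
  have : Fintype κ' := Fintype.ofFinite κ'
  have hcard : Fintype.card κ' ≤ Fintype.card ι := by
    have := hli.fintype_card_le_finrank
    simpa using this
  have hlt : Submodule.span ℚ (Set.range col) ≠ ⊤ := by
    intro htop
    have heq : Fintype.card κ' = Fintype.card ι := by
      have h1 := finrank_span_eq_card hli
      rw [hspan, htop, finrank_top] at h1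
      simpa using h1.symm
    let eq : ι ≃ κ' := (Fintype.equivOfCardEq heq).symm
    have hd := hcon (fun s => g (eq s))
    have hli2 : LinearIndependent ℚ (fun s => col (g (eq s))) := hli.comp eq eq.injective
    have hdet : Matrix.det (Matrix.of fun s r => ((E r (g (eq s)) : ℤ) : ℚ)) ≠ 0 := by
      have := Matrix.linearIndependent_rows_iff_isUnit
        (A := (Matrix.of fun s r => ((E r (g (eq s)) : ℤ) : ℚ))) |>.1 hli2
      rw [Matrix.isUnit_iff_isUnit_det] at this
      exact this.ne_zero
    apply hdet
    rw [← Matrix.det_transpose]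
    have : (Matrix.of fun s r => ((E r (g (eq s)) : ℤ) : ℚ)).transpose
        = (Int.castRingHom ℚ).mapMatrix (Matrix.of fun r s => E r (g (eq s))) := by
      ext; simp
    rw [this, ← RingHom.map_det, hd]; simp
  obtain ⟨φ, hφ0, hφ⟩ := Submodule.exists_le_ker_of_lt_top _ (lt_top_iff_ne_top.2 hlt)
  -- clear denominators
  have hq : ∀ x : ι → ℚ, φ x = ∑ r, x r * φ (Pi.single r 1) := by
    intro x
    conv_lhs => rw [pi_eq_sum_univ' x]
    simp [map_sum]
  let d : ℕ := ∏ r, (φ (Pi.single r 1)).den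
  have hd0 : (d : ℚ) ≠ 0 := by
    simp only [d]
    exact_mod_cast Finset.prod_ne_zero_iff.2 fun r _ => Rat.den_nz _
  have hintc : ∀ r, ∃ c : ℤ, (c : ℚ) = d * φ (Pi.single r 1) := by
    intro r
    obtain ⟨k, hk⟩ := Finset.dvd_prod_of_mem (fun r => (φ (Pi.single r 1)).den) (Finset.mem_univ r)
    refine ⟨k * (φ (Pi.single r 1)).num, ?_⟩
    have : (d : ℚ) = (φ (Pi.single r 1)).den * k := by simp only [d]; exact_mod_cast hk
    rw [this]
    push_cast
    have := Rat.mul_den_eq_num (φ (Pi.single r 1))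
    linear_combination (-(k : ℚ)) * this
  choose c hc using hintc
  have hc0 := h c (by
    intro k
    have h1 : φ (col k) = 0 := hφ (Submodule.subset_span ⟨k, rfl⟩)
    rw [hq] at h1
    have : ((∑ r, c r * E r k : ℤ) : ℚ) = d * ∑ r, col k r * φ (Pi.single r 1) := by
      push_cast
      rw [Finset.mul_sum]
      refine Finset.sum_congr rfl fun r _ => ?_
      rw [hc]; simp only [col]; ring
    rw [h1, mul_zero] at this
    exact_mod_cast this)
  apply hφ0
  ext r
  have h1 := hc r
  rw [hc0] at h1
  simp only [Pi.zero_apply, Int.cast_zero] at h1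
  rcases mul_eq_zero.1 h1.symm with h2 | h2
  · exact absurd h2 hd0
  · simpa using h2

theorem pow_period (q V : ℕ) (a : ℤ) (ha : (q : ℤ) ∣ a - 1) (j : ℕ) :
    (q : ℤ) ^ V ∣ a ^ (1 + j * q ^ V) - a := by
  have h := dvd_sub_pow_of_dvd_sub (R := ℤ) (p := q) (a := a) (b := 1) ha V
  rw [one_pow] at h
  have h1 : (q : ℤ) ^ V ∣ a ^ q ^ V - 1 := (pow_dvd_pow _ (Nat.le_succ V)).trans h
  have h2 : a ^ q ^ V - 1 ∣ (a ^ q ^ V) ^ j - 1 := by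
    simpa using sub_dvd_pow_sub_pow (a ^ q ^ V) 1 j
  have h3 := (h1.trans h2).mul_left a
  have e : a ^ (1 + j * q ^ V) - a = a * ((a ^ q ^ V) ^ j - 1) := by
    rw [pow_add, pow_one, mul_comm j, pow_mul]; ring
  rw [e]
  exact h3

theorem inv_mod (q V n : ℕ) (hq : 3 ≤ q) (hV : 0 < V) (hn : Nat.Coprime n q) :
    ∃ n' j : ℕ, n * n' = 1 + j * q ^ V := by
  have h1 : 1 < q ^ V := Nat.one_lt_pow hV.ne' (by omega)
  obtain ⟨n', h⟩ := Nat.exists_mul_mod_eq_one_of_coprime (hn.pow_right V) h1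
  refine ⟨n', n * n' / q ^ V, ?_⟩
  have := Nat.div_add_mod (n * n') (q ^ V)
  rw [h.2] at this
  rw [mul_comm (n * n' / q ^ V)]
  omega

theorem exists_root (q V m n : ℕ) (hq : 3 ≤ q) (hV : 0 < V) (hn : Nat.Coprime n q) (a b : ℤ)
    (ha : (q : ℤ) ∣ a - 1) (hb : (q : ℤ) ∣ b - 1) (h : (q : ℤ) ^ V ∣ a ^ m - b ^ n) :
    ∃ c : ℤ, (q : ℤ) ∣ c - 1 ∧ (q : ℤ) ^ V ∣ a - c ^ n ∧ (q : ℤ) ^ V ∣ b - c ^ m := by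
  obtain ⟨n', j, hj⟩ := inv_mod q V n hq hV hn
  refine ⟨a ^ n', ha.trans (by simpa using sub_dvd_pow_sub_pow a 1 n'), ?_, ?_⟩
  · rw [← pow_mul, mul_comm n' n, hj]
    exact (dvd_sub_comm).1 (pow_period q V a ha j)
  · have h1 : (q : ℤ) ^ V ∣ (a ^ m) ^ n' - (b ^ n) ^ n' := h.trans (sub_dvd_pow_sub_pow _ _ _)
    rw [← pow_mul b, hj] at h1
    have h2 := dvd_add h1 (pow_period q V b hb j)
    rw [← dvd_neg]
    have e : -(b - (a ^ n') ^ m) = (a ^ m) ^ n' - b ^ (1 + j * q ^ V) + (b ^ (1 + j * q ^ V) - b) := by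
      rw [← pow_mul, ← pow_mul, mul_comm n' m]; ring
    rw [e]
    exact h2

theorem numeric_aux (h : ℕ) (hh : 34 ≤ h) : 4624 * h ^ 4 ≤ 2 ^ h := by
  induction h, hh using Nat.le_induction with
  | base => norm_num
  | succ k hk ih =>
    have : (k + 1) ^ 4 ≤ 2 * k ^ 4 := by
      have h1 : 34 * k ^ 3 ≤ k ^ 4 := by
        calc 34 * k ^ 3 ≤ k * k ^ 3 := Nat.mul_le_mul_right _ hk
          _ = k ^ 4 := by ring
      have h2 : 34 * k ^ 2 ≤ k ^ 3 := by
        calc 34 * k ^ 2 ≤ k * k ^ 2 := Nat.mul_le_mul_right _ hk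
          _ = k ^ 3 := by ring
      have h3 : 34 * k ≤ k ^ 2 := by nlinarith
      nlinarith
    rw [pow_succ 2]; nlinarith

theorem sum_trunc (K M : ℕ) (hKM : K + 1 ≤ M) :
    2 * ∑ i ∈ Finset.range M, (i - K) = (M - K) * (M - K - 1) := by
  obtain ⟨d, rfl⟩ := Nat.exists_eq_add_of_le (show K ≤ M by omega)
  rw [Finset.sum_range_add]
  have h1 : ∑ x ∈ Finset.range K, (x - K) = 0 :=
    Finset.sum_eq_zero fun x hx => by have := Finset.mem_range.1 hx; omega
  have h2 : ∑ x ∈ Finset.range d, (K + x - K) = ∑ x ∈ Finset.range d, x :=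
    Finset.sum_congr rfl fun x _ => by omega
  rw [h1, h2, zero_add, mul_comm, Finset.sum_range_id_mul_two]
  simp

theorem grid_inj (m n I : ℕ) (hmn : Nat.Coprime m n) (hm : 0 < m) (hn : 0 < n)
    (hI : I ≤ m ∨ I ≤ n)
    (i j i' j' : ℕ) (hi : i < I) (hj : j < I) (hi' : i' < I) (hj' : j' < I)
    (h : i * n + j * m = i' * n + j' * m) : i = i' ∧ j = j' := by
  have hZ : ((i : ℤ) - i') * n = ((j' : ℤ) - j) * m := by
    have : (i : ℤ) * n + j * m = i' * n + j' * m := by exact_mod_cast h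
    linarith
  have hco : IsCoprime (m : ℤ) (n : ℤ) := Nat.isCoprime_iff_coprime.2 hmn
  have hm' : (m : ℤ) ≠ 0 := by exact_mod_cast hm.ne'
  have hn' : (n : ℤ) ≠ 0 := by exact_mod_cast hn.ne'
  rcases hI with hI | hI
  · have h1 : (m : ℤ) ∣ (i : ℤ) - i' := hco.dvd_of_dvd_mul_right ⟨(j' : ℤ) - j, by rw [hZ]; ring⟩
    have h2 : (i : ℤ) - i' = 0 := Int.eq_zero_of_abs_lt_dvd h1 (by rw [abs_lt]; constructor <;> omega)
    rw [h2, zero_mul] at hZ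
    have h3 := (mul_eq_zero.1 hZ.symm).resolve_right hm'
    omega
  · have h1 : (n : ℤ) ∣ (j' : ℤ) - j := hco.symm.dvd_of_dvd_mul_right ⟨(i : ℤ) - i', by rw [← hZ]; ring⟩
    have h2 : (j' : ℤ) - j = 0 := Int.eq_zero_of_abs_lt_dvd h1 (by rw [abs_lt]; constructor <;> omega)
    rw [h2, zero_mul] at hZ
    have h3 := (mul_eq_zero.1 hZ).resolve_right hn'
    omega

set_option maxHeartbeats 4000000 in
/-- A crude lower bound for linear forms in two `p`-adic logarithms. -/
theorem core (a b : ℤ) (q V m n h A : ℕ) (hq : 3 ≤ q) (ha : (q : ℤ) ∣ a - 1)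
    (hb : (q : ℤ) ∣ b - 1) (ha0 : a ≠ 0) (hb0 : b ≠ 0)
    (hab : ∀ i j i' j' : ℕ, a ^ i * b ^ j = a ^ i' * b ^ j' → i = i' ∧ j = j')
    (haA : |a| ≤ A) (hbA : |b| ≤ A) (hA : A ^ 2 ≤ 2 ^ (h + 3))
    (hm : 0 < m) (hn : 0 < n) (hmn : Nat.Coprime m n) (hnq : Nat.Coprime n q)
    (hmB : m ≤ 2 ^ (h + 1)) (hnB : n ≤ 2 ^ (h + 1)) (hh : 34 ≤ h) (hV : 256 * h ^ 4 ≤ V)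
    (hdvd : (q : ℤ) ^ V ∣ a ^ m - b ^ n) : False := by
  have hA1 : 1 ≤ A := by
    have : 1 ≤ |a| := Int.one_le_abs ha0
    exact_mod_cast this.trans haA
  have p43 : 34 * h ^ 3 ≤ h ^ 4 := by
    calc 34 * h ^ 3 ≤ h * h ^ 3 := Nat.mul_le_mul_right _ hh
      _ = h ^ 4 := by ring
  have p32 : 34 * h ^ 2 ≤ h ^ 3 := by
    calc 34 * h ^ 2 ≤ h * h ^ 2 := Nat.mul_le_mul_right _ hh
      _ = h ^ 3 := by ring
  have p21 : 34 * h ≤ h ^ 2 := by nlinarith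
  have hq3 : ∀ k : ℕ, (2 : ℤ) ^ k ≤ (q : ℤ) ^ k := fun k =>
    pow_le_pow_left₀ (by norm_num) (by exact_mod_cast (by omega : 2 ≤ q)) k
  by_cases hdeg : m < 16 * h ^ 2 ∧ n < 16 * h ^ 2
  · -- degenerate case
    obtain ⟨hm1, hn1⟩ := hdeg
    have hne : a ^ m - b ^ n ≠ 0 := by
      intro h0
      have := hab m 0 0 n (by simpa using sub_eq_zero.1 h0)
      omega
    have hle : (q : ℤ) ^ V ≤ |a ^ m - b ^ n| := Int.le_of_dvd (abs_pos.2 hne) ((dvd_abs _ _).2 hdvd)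
    have hbd : ∀ (c : ℤ) (k : ℕ), |c| ≤ A → k < 16 * h ^ 2 →
        |c ^ k| ≤ (2 : ℤ) ^ ((h + 3) * (8 * h ^ 2)) := by
      intro c k hc hk
      rw [abs_pow]
      calc |c| ^ k ≤ (A : ℤ) ^ k := pow_le_pow_left₀ (abs_nonneg _) hc k
        _ ≤ (A : ℤ) ^ (2 * (8 * h ^ 2)) :=
            pow_le_pow_right₀ (by exact_mod_cast hA1) (by omega)
        _ = ((A : ℤ) ^ 2) ^ (8 * h ^ 2) := by rw [pow_mul]
        _ ≤ ((2 : ℤ) ^ (h + 3)) ^ (8 * h ^ 2) :=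
            pow_le_pow_left₀ (by positivity) (by exact_mod_cast hA) _
        _ = _ := by rw [← pow_mul]
    have h1 := hbd a m haA hm1
    have h2 := hbd b n hbA hn1
    have h3 := abs_sub (a ^ m) (b ^ n)
    have h4 : (2 : ℤ) ^ ((h + 3) * (8 * h ^ 2) + 1) < 2 ^ V := by
      refine pow_lt_pow_right₀ (by norm_num) ?_
      nlinarith
    have h5 := hq3 V
    rw [pow_succ] at h4
    linarith
  · have hdeg' : 16 * h ^ 2 ≤ m ∨ 16 * h ^ 2 ≤ n := by
      by_contra hcon; push Not at hcon; exact hdeg hcon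
    obtain ⟨K, hK⟩ : ∃ k : ℕ, k = 64 * h ^ 3 := ⟨_, rfl⟩
    obtain ⟨L, hL⟩ : ∃ k : ℕ, k = 4 * h := ⟨_, rfl⟩
    obtain ⟨I₁, hI₁⟩ : ∃ k : ℕ, k = 2 * h := ⟨_, rfl⟩
    obtain ⟨I₂, hI₂⟩ : ∃ k : ℕ, k = 16 * h ^ 2 := ⟨_, rfl⟩
    have hM : K * L = 256 * h ^ 4 := by rw [hK, hL]; ring
    have hh0 : 0 < h := by omega
    have hKpos : 0 < K := by rw [hK]; positivity
    have hh4 : 0 < h ^ 4 := by positivity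
    obtain ⟨c, hc1, hc2, hc3⟩ := exists_root q V m n hq (by omega) hnq a b ha hb hdvd
    obtain ⟨f, hf⟩ := exists_minor (ι := Fin K × Fin L) (κ := Fin (I₁ + I₂) × Fin (I₁ + I₂))
      (fun r t => ((((t.1 : ℕ) * n + (t.2 : ℕ) * m : ℕ) : ℤ) ^ (r.1 : ℕ) *
        (a ^ (t.1 : ℕ) * b ^ (t.2 : ℕ)) ^ (r.2 : ℕ))) (by
        intro c hc
        refine zero_estimate a b ha0 hb0 m n K L I₁ I₂ hKpos hab ?_ ?_ ?_ c ?_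
        · rw [hI₁, hL]; nlinarith
        · exact grid_inj m n I₂ hmn hm hn (by rw [hI₂]; exact hdeg')
        · have : (K - 1) * L < K * L := Nat.mul_lt_mul_of_pos_right (by omega) (by omega)
          have e : I₂ * I₂ = K * L := by rw [hM, hI₂]; ring
          omega
        · intro i j hi hj
          exact hc (⟨i, hi⟩, ⟨j, hj⟩))
    obtain ⟨Z, hZ⟩ : ∃ Z : Fin K × Fin L → ℕ, ∀ s, Z s = ((f s).1 : ℕ) * n + ((f s).2 : ℕ) * m :=
      ⟨_, fun _ => rfl⟩
    obtain ⟨Y, hY⟩ : ∃ Y : Fin K × Fin L → ℤ, ∀ s, Y s = a ^ ((f s).1 : ℕ) * b ^ ((f s).2 : ℕ) :=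
      ⟨_, fun _ => rfl⟩
    simp only [← hZ, ← hY] at hf
    have hdet := interp_det_dvd q K L V c hc1 Z Y (by
      intro s
      have e1 : (q : ℤ) ^ V ∣ a ^ ((f s).1 : ℕ) - (c ^ n) ^ ((f s).1 : ℕ) :=
        hc2.trans (sub_dvd_pow_sub_pow _ _ _)
      have e2 : (q : ℤ) ^ V ∣ b ^ ((f s).2 : ℕ) - (c ^ m) ^ ((f s).2 : ℕ) :=
        hc3.trans (sub_dvd_pow_sub_pow _ _ _)
      have e3 := dvd_add (e1.mul_right (b ^ ((f s).2 : ℕ)))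
        (e2.mul_left ((c ^ n) ^ ((f s).1 : ℕ)))
      have e4 : Y s - c ^ Z s = (a ^ ((f s).1 : ℕ) - (c ^ n) ^ ((f s).1 : ℕ)) * b ^ ((f s).2 : ℕ)
          + (c ^ n) ^ ((f s).1 : ℕ) * (b ^ ((f s).2 : ℕ) - (c ^ m) ^ ((f s).2 : ℕ)) := by
        rw [hY s, hZ s, pow_add, mul_comm ((f s).1 : ℕ) n, mul_comm ((f s).2 : ℕ) m, pow_mul,
          pow_mul]
        ring
      rw [e4]
      exact e3) (by omega)
    obtain ⟨S, hS⟩ : ∃ S, S = ∑ i ∈ Finset.range (K * L), (i - K) := ⟨_, rfl⟩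
    rw [← hS] at hdet
    have hle := Int.le_of_dvd (abs_pos.2 hf) ((dvd_abs _ _).2 hdet)
    -- bound for the entries
    obtain ⟨W, hW⟩ : ∃ W : ℕ, W = 2 * (I₁ + I₂) * 2 ^ (h + 1) := ⟨_, rfl⟩
    have hIle : I₁ + I₂ ≤ 17 * h ^ 2 := by rw [hI₁, hI₂]; nlinarith
    have hW2 : W ^ 2 ≤ 2 ^ (3 * h) := by
      have h1 := numeric_aux h hh
      calc W ^ 2 ≤ (2 * (17 * h ^ 2) * 2 ^ (h + 1)) ^ 2 := by
            rw [hW]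
            exact Nat.pow_le_pow_left (Nat.mul_le_mul_right _ (Nat.mul_le_mul_left _ hIle)) 2
        _ = 4624 * h ^ 4 * 2 ^ (2 * h) := by
            rw [show 2 * h = h * 2 by ring, pow_mul, pow_succ]; ring
        _ ≤ 2 ^ h * 2 ^ (2 * h) := Nat.mul_le_mul_right _ h1
        _ = 2 ^ (3 * h) := by rw [← pow_add]; congr 1; ring
    have hW1 : 1 ≤ W := by
      rw [hW]; have : 0 < 2 ^ (h + 1) := by positivity
      have : 0 < I₁ := by omega
      exact Nat.succ_le_of_lt (by positivity)
    have hent : ∀ r s : Fin K × Fin L,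
        |(Z s : ℤ) ^ (r.1 : ℕ) * Y s ^ (r.2 : ℕ)| ≤ (2 : ℤ) ^ (166 * h ^ 4) := by
      intro r s
      have hZW : Z s ≤ W := by
        have h1 : ((f s).1 : ℕ) ≤ I₁ + I₂ := (f s).1.2.le
        have h2 : ((f s).2 : ℕ) ≤ I₁ + I₂ := (f s).2.2.le
        have h3 := Nat.mul_le_mul h1 hnB
        have h4 := Nat.mul_le_mul h2 hmB
        simp only [hZ, hW]
        nlinarith
      have e1 : |(Z s : ℤ) ^ (r.1 : ℕ)| ≤ (2 : ℤ) ^ (96 * h ^ 4) := by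
        rw [abs_of_nonneg (by positivity)]
        have : Z s ^ (r.1 : ℕ) ≤ 2 ^ (96 * h ^ 4) := by
          calc Z s ^ (r.1 : ℕ) ≤ W ^ (r.1 : ℕ) := Nat.pow_le_pow_left hZW _
            _ ≤ W ^ (2 * (32 * h ^ 3)) :=
                Nat.pow_le_pow_right hW1 (by have := r.1.2; omega)
            _ = (W ^ 2) ^ (32 * h ^ 3) := by rw [pow_mul]
            _ ≤ (2 ^ (3 * h)) ^ (32 * h ^ 3) := Nat.pow_le_pow_left hW2 _
            _ = 2 ^ (96 * h ^ 4) := by rw [← pow_mul]; congr 1; ring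
        exact_mod_cast this
      have e2 : |Y s ^ (r.2 : ℕ)| ≤ (2 : ℤ) ^ (70 * h ^ 4) := by
        have hYA : |Y s| ≤ ((A : ℤ) ^ 2) ^ (I₁ + I₂) := by
          simp only [hY, abs_mul, abs_pow]
          have g1 : |a| ^ ((f s).1 : ℕ) ≤ (A : ℤ) ^ (I₁ + I₂) :=
            (pow_le_pow_left₀ (abs_nonneg _) haA _).trans
              (pow_le_pow_right₀ (by exact_mod_cast hA1) (f s).1.2.le)
          have g2 : |b| ^ ((f s).2 : ℕ) ≤ (A : ℤ) ^ (I₁ + I₂) :=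
            (pow_le_pow_left₀ (abs_nonneg _) hbA _).trans
              (pow_le_pow_right₀ (by exact_mod_cast hA1) (f s).2.2.le)
          calc _ ≤ (A : ℤ) ^ (I₁ + I₂) * (A : ℤ) ^ (I₁ + I₂) :=
                mul_le_mul g1 g2 (by positivity) (by positivity)
            _ = _ := by rw [← pow_mul, ← pow_add]; congr 1; ring
        have hYA2 : |Y s| ≤ (2 : ℤ) ^ ((h + 3) * (I₁ + I₂)) := by
          refine hYA.trans ?_
          rw [pow_mul (2 : ℤ)]
          exact pow_le_pow_left₀ (by positivity) (by exact_mod_cast hA) _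
        rw [abs_pow]
        calc |Y s| ^ (r.2 : ℕ) ≤ ((2 : ℤ) ^ ((h + 3) * (I₁ + I₂))) ^ (r.2 : ℕ) :=
              pow_le_pow_left₀ (abs_nonneg _) hYA2 _
          _ = (2 : ℤ) ^ ((h + 3) * (I₁ + I₂) * (r.2 : ℕ)) := by rw [← pow_mul]
          _ ≤ (2 : ℤ) ^ (70 * h ^ 4) := by
              refine pow_le_pow_right₀ (by norm_num) ?_
              calc (h + 3) * (I₁ + I₂) * (r.2 : ℕ) ≤ (h + 3) * (I₁ + I₂) * (4 * h) :=
                    Nat.mul_le_mul_left _ (by have := r.2.2; omega)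
                _ = 64 * h ^ 4 + 200 * h ^ 3 + 24 * h ^ 2 := by rw [hI₁, hI₂]; ring
                _ ≤ 70 * h ^ 4 := by linarith
      rw [abs_mul]
      calc _ ≤ (2 : ℤ) ^ (96 * h ^ 4) * (2 : ℤ) ^ (70 * h ^ 4) :=
            mul_le_mul e1 e2 (abs_nonneg _) (by positivity)
        _ = _ := by rw [← pow_add]; congr 1; ring
    have hdetle := Matrix.det_le (A := (Matrix.of fun r s : Fin K × Fin L =>
      (Z s : ℤ) ^ (r.1 : ℕ) * Y s ^ (r.2 : ℕ))) (abv := AbsoluteValue.abs)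
      (x := (2 : ℤ) ^ (166 * h ^ 4)) (fun r s => hent r s)
    have hcard : Fintype.card (Fin K × Fin L) = 256 * h ^ 4 := by simp [hM]
    rw [hcard] at hdetle
    have hfac : (256 * h ^ 4).factorial ≤ (2 ^ h ^ 4) ^ (256 * h ^ 4) := by
      refine (Nat.factorial_le_pow _).trans (Nat.pow_le_pow_left ?_ _)
      have h1 := numeric_aux h hh
      have h2 : 2 ^ h ≤ 2 ^ h ^ 4 := Nat.pow_le_pow_right (by norm_num) (by nlinarith)
      omega
    have hfinal : (q : ℤ) ^ S ≤ (2 : ℤ) ^ (167 * h ^ 4 * (256 * h ^ 4)) := by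
      refine hle.trans (hdetle.trans ?_)
      rw [nsmul_eq_mul]
      calc ((256 * h ^ 4).factorial : ℤ) * ((2 : ℤ) ^ (166 * h ^ 4)) ^ (256 * h ^ 4)
          ≤ ((2 : ℤ) ^ h ^ 4) ^ (256 * h ^ 4) * ((2 : ℤ) ^ (166 * h ^ 4)) ^ (256 * h ^ 4) :=
            mul_le_mul_of_nonneg_right (by exact_mod_cast hfac) (by positivity)
        _ = _ := by rw [← mul_pow, ← pow_add, ← pow_mul]; congr 1; ring
    have hfinal' : q ^ S ≤ 2 ^ (167 * h ^ 4 * (256 * h ^ 4)) := by exact_mod_cast hfinal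
    have h9 : 2 ^ (3 * S) ≤ 2 ^ (2 * (167 * h ^ 4 * (256 * h ^ 4))) := by
      calc 2 ^ (3 * S) = 8 ^ S := by rw [pow_mul]; norm_num
        _ ≤ (q ^ 2) ^ S := Nat.pow_le_pow_left (by nlinarith) _
        _ = (q ^ S) ^ 2 := by rw [← pow_mul, ← pow_mul, mul_comm]
        _ ≤ (2 ^ (167 * h ^ 4 * (256 * h ^ 4))) ^ 2 := Nat.pow_le_pow_left hfinal' 2
        _ = _ := by rw [← pow_mul, mul_comm]
    have h10 : 3 * S ≤ 2 * (167 * h ^ 4 * (256 * h ^ 4)) :=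
      (Nat.pow_le_pow_iff_right (by norm_num)).1 h9
    have hKL : K + 1 ≤ 2 * h ^ 4 := by rw [hK]; linarith
    have h11 := sum_trunc K (K * L) (by omega)
    rw [← hS] at h11
    have h12 : 254 * h ^ 4 * (254 * h ^ 4) ≤ 2 * S := by
      rw [h11]
      exact Nat.mul_le_mul (by omega) (by omega)
    have hP : 0 < h ^ 4 * h ^ 4 := by positivity
    have h13 : 3 * S ≤ 85504 * (h ^ 4 * h ^ 4) := by
      refine h10.trans (le_of_eq ?_); ring
    have h14 : 64516 * (h ^ 4 * h ^ 4) ≤ 2 * S := by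
      refine le_trans (le_of_eq ?_) h12; ring
    omega

theorem mult_indep_aux (a b : ℤ) (hc : IsCoprime a b) (ha0 : a ≠ 0) (ha : ¬ IsUnit a)
    (i j i' j' : ℕ) (h : a ^ i * b ^ j = a ^ i' * b ^ j') : i' ≤ i := by
  by_contra hlt
  push Not at hlt
  obtain ⟨k, rfl⟩ := Nat.exists_eq_add_of_lt hlt
  rw [pow_succ, pow_add, mul_assoc, mul_assoc] at h
  have h1 := mul_left_cancel₀ (pow_ne_zero _ ha0) h
  have h2 : a ∣ b ^ j := by rw [h1]; exact (dvd_mul_right _ _).mul_left _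
  exact ha ((hc.pow_right (n := j)).isUnit_of_dvd' dvd_rfl h2)

theorem mult_indep (a b : ℤ) (hc : IsCoprime a b) (ha0 : a ≠ 0) (hb0 : b ≠ 0) (ha : ¬ IsUnit a)
    (hb : ¬ IsUnit b) (i j i' j' : ℕ) (h : a ^ i * b ^ j = a ^ i' * b ^ j') :
    i = i' ∧ j = j' := by
  have h' : b ^ j * a ^ i = b ^ j' * a ^ i' := by rw [mul_comm, h, mul_comm]
  exact ⟨le_antisymm (mult_indep_aux a b hc ha0 ha _ _ _ _ h.symm)
    (mult_indep_aux a b hc ha0 ha _ _ _ _ h),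
    le_antisymm (mult_indep_aux b a hc.symm hb0 hb _ _ _ _ h'.symm)
    (mult_indep_aux b a hc.symm hb0 hb _ _ _ _ h')⟩

theorem core_sym (a b : ℤ) (q V m n h A : ℕ) (hq : 3 ≤ q) (ha : (q : ℤ) ∣ a - 1)
    (hb : (q : ℤ) ∣ b - 1) (ha0 : a ≠ 0) (hb0 : b ≠ 0) (hau : ¬ IsUnit a) (hbu : ¬ IsUnit b)
    (hab : IsCoprime a b)
    (haA : |a| ≤ A) (hbA : |b| ≤ A) (hA : A ^ 2 ≤ 2 ^ (h + 3))
    (hm : 0 < m) (hn : 0 < n) (hmn : Nat.Coprime m n) (hnq : Nat.Coprime n q ∨ Nat.Coprime m q)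
    (hmB : m ≤ 2 ^ (h + 1)) (hnB : n ≤ 2 ^ (h + 1)) (hh : 34 ≤ h) (hV : 256 * h ^ 4 ≤ V)
    (hdvd : (q : ℤ) ^ V ∣ a ^ m - b ^ n) : False := by
  rcases hnq with hnq | hnq
  · exact core a b q V m n h A hq ha hb ha0 hb0 (mult_indep a b hab ha0 hb0 hau hbu) haA hbA hA hm hn
      hmn hnq hmB hnB hh hV hdvd
  · exact core b a q V n m h A hq hb ha hb0 ha0 (mult_indep b a hab.symm hb0 ha0 hbu hau) hbA haA hA
      hn hm hmn.symm hnq hnB hmB hh hV (dvd_sub_comm.1 hdvd)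

theorem reduce_coprime (q V g : ℕ) (c d : ℤ) (hq : 3 ≤ q) (hV : 0 < V) (hg : Nat.Coprime g q)
    (hc : (q : ℤ) ∣ c - 1) (hd : (q : ℤ) ∣ d - 1) (h : (q : ℤ) ^ V ∣ c ^ g - d ^ g) :
    (q : ℤ) ^ V ∣ c - d := by
  obtain ⟨r, j, hj⟩ := inv_mod q V g hq hV hg
  have h1 : (q : ℤ) ^ V ∣ (c ^ g) ^ r - (d ^ g) ^ r := h.trans (sub_dvd_pow_sub_pow _ _ _)
  rw [← pow_mul, ← pow_mul, hj] at h1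
  have h2 := pow_period q V c hc j
  have h3 := pow_period q V d hd j
  have e : c - d = (c ^ (1 + j * q ^ V) - d ^ (1 + j * q ^ V) + (d ^ (1 + j * q ^ V) - d))
      - (c ^ (1 + j * q ^ V) - c) := by abel
  rw [e]
  exact dvd_sub (dvd_add h1 h3) h2

theorem reduce_three (k : ℕ) : ∀ (V : ℕ) (c d : ℤ), (3 : ℤ) ∣ c - 1 → (3 : ℤ) ∣ d - 1 →
    (3 : ℤ) ^ (V + k) ∣ c ^ 3 ^ k - d ^ 3 ^ k → (3 : ℤ) ^ V ∣ c - d := by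
  induction k with
  | zero => intro V c d _ _ h; simpa using h
  | succ k ih =>
    intro V c d hc hd h
    have hc' : (3 : ℤ) ∣ c ^ 3 - 1 := hc.trans (by simpa using sub_dvd_pow_sub_pow c 1 3)
    have hd' : (3 : ℤ) ∣ d ^ 3 - 1 := hd.trans (by simpa using sub_dvd_pow_sub_pow d 1 3)
    have h1 := ih (V + 1) (c ^ 3) (d ^ 3) hc' hd' (by
      rw [← pow_mul, ← pow_mul, show 3 * 3 ^ k = 3 ^ (k + 1) by ring,
        show V + 1 + k = V + (k + 1) by ring]
      exact h)
    obtain ⟨u, hu⟩ := hc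
    obtain ⟨v, hv⟩ := hd
    obtain rfl : c = 1 + 3 * u := by linarith
    obtain rfl : d = 1 + 3 * v := by linarith
    have e : (1 + 3 * u) ^ 3 - (1 + 3 * v) ^ 3 =
        3 * ((1 + 3 * u - (1 + 3 * v)) * (1 + 3 * (u + v + u ^ 2 + u * v + v ^ 2))) := by ring
    rw [e, pow_succ, mul_comm ((3 : ℤ) ^ V)] at h1
    have h2 := (mul_dvd_mul_iff_left (by norm_num : (3 : ℤ) ≠ 0)).1 h1
    have hco : IsCoprime (3 : ℤ) (1 + 3 * (u + v + u ^ 2 + u * v + v ^ 2)) :=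
      ⟨-(u + v + u ^ 2 + u * v + v ^ 2), 1, by ring⟩
    exact (hco.pow_left (m := V)).dvd_of_dvd_mul_right h2

theorem core4 (a b : ℤ) (V m n h A : ℕ) (ha : (4 : ℤ) ∣ a - 1)
    (hb : (4 : ℤ) ∣ b - 1) (ha0 : a ≠ 0) (hb0 : b ≠ 0) (hau : ¬ IsUnit a) (hbu : ¬ IsUnit b)
    (hab : IsCoprime a b)
    (haA : |a| ≤ A) (hbA : |b| ≤ A) (hA : A ^ 2 ≤ 2 ^ (h + 3))
    (hm : Odd m) (hn : Odd n)
    (hmB : m ≤ 2 ^ (h + 1)) (hnB : n ≤ 2 ^ (h + 1)) (hh : 34 ≤ h) (hV : 256 * h ^ 4 ≤ V)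
    (hdvd : (4 : ℤ) ^ V ∣ a ^ m - b ^ n) : False := by
  obtain ⟨g, m', n', hg, hmn, rfl, rfl⟩ := Nat.exists_coprime' (m := m) (n := n)
    (Nat.gcd_pos_of_pos_left _ hm.pos)
  have hgo : Odd g := (Nat.odd_mul.1 hm).2
  have hmo : Odd m' := (Nat.odd_mul.1 hm).1
  have hno : Odd n' := (Nat.odd_mul.1 hn).1
  have h4 : ∀ k : ℕ, Odd k → Nat.Coprime k 4 := fun k hk => by
    have := (Nat.coprime_two_right.2 hk).pow_right 2
    simpa using this
  have hVpos : 0 < V := by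
    have : 0 < h ^ 4 := by have : 0 < h := by omega
                           positivity
    omega
  rw [pow_mul, pow_mul] at hdvd
  have h1 := reduce_coprime 4 V g (a ^ m') (b ^ n') (by norm_num) hVpos (h4 g hgo)
    (ha.trans (by simpa using sub_dvd_pow_sub_pow a 1 m'))
    (hb.trans (by simpa using sub_dvd_pow_sub_pow b 1 n')) hdvd
  exact core_sym a b 4 V m' n' h A (by norm_num) ha hb ha0 hb0 hau hbu hab haA hbA hA hmo.pos hno.pos
    hmn (Or.inl (h4 _ hno)) ((Nat.le_mul_of_pos_right _ hg).trans hmB)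
    ((Nat.le_mul_of_pos_right _ hg).trans hnB) hh hV h1

theorem core3 (a b : ℤ) (V m n h A : ℕ) (ha : (3 : ℤ) ∣ a - 1)
    (hb : (3 : ℤ) ∣ b - 1) (ha0 : a ≠ 0) (hb0 : b ≠ 0) (hau : ¬ IsUnit a) (hbu : ¬ IsUnit b)
    (hab : IsCoprime a b)
    (haA : |a| ≤ A) (hbA : |b| ≤ A) (hA : A ^ 2 ≤ 2 ^ (h + 3))
    (hm : 0 < m) (hn : 0 < n)
    (hmB : m ≤ 2 ^ (h + 1)) (hnB : n ≤ 2 ^ (h + 1)) (hh : 34 ≤ h)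
    (hV : 256 * h ^ 4 + (h + 1) ≤ V)
    (hdvd : (3 : ℤ) ^ V ∣ a ^ m - b ^ n) : False := by
  obtain ⟨g, m', n', hg, hmn, rfl, rfl⟩ := Nat.exists_coprime' (m := m) (n := n)
    (Nat.gcd_pos_of_pos_left _ hm)
  obtain ⟨k, g', hg3, rfl⟩ := Nat.exists_eq_pow_mul_and_not_dvd hg.ne' 3 (by norm_num)
  have hm' : 0 < m' := Nat.pos_of_mul_pos_right hm
  have hn' : 0 < n' := Nat.pos_of_mul_pos_right hn
  have hg' : 0 < g' := Nat.pos_of_mul_pos_left hg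
  have h3 : ∀ j : ℕ, ¬ 3 ∣ j → Nat.Coprime j 3 := fun j hj =>
    ((Nat.Prime.coprime_iff_not_dvd Nat.prime_three).2 hj).symm
  have hk : k ≤ h + 1 := by
    have h1 : 3 ^ k ≤ 2 ^ (h + 1) := by
      refine le_trans ?_ hmB
      calc 3 ^ k ≤ 3 ^ k * g' := Nat.le_mul_of_pos_right _ hg'
        _ ≤ _ := Nat.le_mul_of_pos_left _ hm'
    have h2 : 2 ^ k ≤ 2 ^ (h + 1) := (Nat.pow_le_pow_left (by norm_num) k).trans h1
    exact (Nat.pow_le_pow_iff_right (by norm_num)).1 h2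
  have hh4 : 0 < h ^ 4 := by
    have : 0 < h := by omega
    positivity
  obtain ⟨U, rfl⟩ : ∃ U, V = U + k := ⟨V - k, by omega⟩
  have hcm : ∀ (c : ℤ) (j : ℕ), (3 : ℤ) ∣ c - 1 → (3 : ℤ) ∣ c ^ j - 1 := fun c j hc =>
    hc.trans (by simpa using sub_dvd_pow_sub_pow c 1 j)
  rw [← mul_assoc, ← mul_assoc, pow_mul, pow_mul b] at hdvd
  have h1 := reduce_coprime 3 (U + k) g' (a ^ (m' * 3 ^ k)) (b ^ (n' * 3 ^ k)) (by norm_num)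
    (by omega) (h3 g' hg3) (hcm _ _ ha) (hcm _ _ hb) hdvd
  rw [pow_mul, pow_mul] at h1
  have h2 := reduce_three k U (a ^ m') (b ^ n') (hcm _ _ ha) (hcm _ _ hb) h1
  have hcop : Nat.Coprime n' 3 ∨ Nat.Coprime m' 3 := by
    by_cases hd : 3 ∣ n'
    · right
      apply h3
      intro hd2
      have := Nat.dvd_gcd hd2 hd
      rw [hmn] at this
      omega
    · exact Or.inl (h3 _ hd)
  exact core_sym a b 3 U m' n' h A (by norm_num) ha hb ha0 hb0 hau hbu hab haA hbA hA hm' hn'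
    hmn hcop ((Nat.le_mul_of_pos_right _ hg).trans hmB)
    ((Nat.le_mul_of_pos_right _ hg).trans hnB) hh (by omega) h2

theorem exp3 (T : ℤ) (n : ℕ) : ∃ R k j : ℤ, (n : ℤ) * (n - 1) * (n - 2) = 6 * k ∧
    (n : ℤ) * (n - 1) = 2 * j ∧
    6 * (1 + T) ^ n = 6 + 6 * n * T + 3 * (n * (n - 1)) * T ^ 2
      + n * (n - 1) * (n - 2) * T ^ 3 + 6 * T ^ 4 * R := by
  induction n with
  | zero => exact ⟨0, 0, 0, by simp, by simp, by simp⟩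
  | succ n ih =>
    obtain ⟨R, k, j, hk, hj, h⟩ := ih
    refine ⟨R * (1 + T) + k, k + j, j + n, ?_, ?_, ?_⟩
    · push_cast; linear_combination hk + 3 * hj
    · push_cast; linear_combination hj
    · push_cast
      rw [pow_succ]
      linear_combination (1 + T) * h + T ^ 4 * hk

set_option maxHeartbeats 2000000 in
theorem two_adic_s15 (e x y z : ℕ) (he : 2 ≤ e) (hx : Odd x) (hy : Odd y) (hz : Odd z)
    (h : ((4 : ℤ) ^ e) ^ 4 ∣ (1 + 4 ^ e) ^ z + (4 ^ e) ^ y - (1 - 4 ^ e) ^ x) :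
    ((4 : ℤ) ^ e) ^ 2 ≤ 2 * x ∨ ((4 : ℤ) ^ e) ^ 2 ≤ 2 * z := by
  obtain ⟨N, hN⟩ : ∃ N : ℤ, N = 4 ^ e := ⟨_, rfl⟩
  obtain ⟨f, rfl⟩ := Nat.exists_eq_add_of_le he
  obtain ⟨M, hM⟩ : ∃ M : ℤ, M = 4 ^ (1 + f) := ⟨_, rfl⟩
  obtain ⟨M', hM'⟩ : ∃ M : ℤ, M = 4 ^ f := ⟨_, rfl⟩
  have hNM : N = 4 * M := by rw [hN, hM]; ring
  have hMM' : M = 4 * M' := by rw [hM, hM']; ring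
  have hM'pos : 1 ≤ M' := by rw [hM']; exact one_le_pow₀ (by norm_num)
  have h3 : ∀ k : ℤ, ∀ P : ℤ, IsCoprime P 3 → P ∣ 3 * k → P ∣ k := fun k P hc hd =>
    hc.dvd_of_dvd_mul_left hd
  have hcM' : IsCoprime M 3 := by
    rw [hM]; exact IsCoprime.pow_left ⟨1, -1, by norm_num⟩
  have hcN : IsCoprime N 3 := by
    rw [hN]; exact IsCoprime.pow_left ⟨1, -1, by norm_num⟩
  rw [← hN] at h ⊢
  obtain ⟨Q, hQ⟩ := h
  obtain ⟨R1, _, _, _, _, h1⟩ := exp3 N z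
  obtain ⟨R2, _, _, _, _, h2⟩ := exp3 (-N) x
  rw [← sub_eq_add_neg] at h2
  have hNpos : 0 < N := by omega
  have hN0 : N ≠ 0 := hNpos.ne'
  obtain ⟨x', hx'⟩ := hx
  obtain ⟨z', hz'⟩ := hz
  have hxZ : (x : ℤ) = 2 * x' + 1 := by exact_mod_cast hx'
  have hzZ : (z : ℤ) = 2 * z' + 1 := by exact_mod_cast hz'
  obtain ⟨X, hX⟩ : ∃ X : ℤ, X = x := ⟨_, rfl⟩
  obtain ⟨Z, hZ⟩ : ∃ Z : ℤ, Z = z := ⟨_, rfl⟩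
  have hX0 : 0 ≤ X := by omega
  have hZ0 : 0 ≤ Z := by omega
  rw [← hX] at h2 hxZ ⊢
  rw [← hZ] at h1 hzZ ⊢
  obtain ⟨R, hR⟩ : ∃ R, R = Q - R1 + R2 := ⟨_, rfl⟩
  have h5 : 6 * (X + Z) * N + 3 * (Z * (Z - 1) - X * (X - 1)) * N ^ 2 +
      (Z * (Z - 1) * (Z - 2) + X * (X - 1) * (X - 2)) * N ^ 3 + 6 * N ^ y = 6 * N ^ 4 * R := by
    rw [hR]; linear_combination 6 * hQ - h1 + h2
  -- y is not one
  have hy3 : 3 ≤ y := by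
    by_contra hlt
    have hy1 : y = 1 := by obtain ⟨r, hr⟩ := hy; omega
    rw [hy1, pow_one] at h5
    have h6 : 6 * (X + Z) + 3 * (Z * (Z - 1) - X * (X - 1)) * N +
      (Z * (Z - 1) * (Z - 2) + X * (X - 1) * (X - 2)) * N ^ 2 + 6 = 6 * N ^ 3 * R := by
      apply mul_right_cancel₀ hN0; linear_combination h5
    have h7 : (4 : ℤ) ∣ 6 := by
      refine ⟨6 * M * N ^ 2 * R - 3 * (x' + z' + 1) - 3 * (Z * (Z - 1) - X * (X - 1)) * M -
        (Z * (Z - 1) * (Z - 2) + X * (X - 1) * (X - 2)) * M * N, ?_⟩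
      have e1 : 6 * (X + Z) = 12 * (x' + z' + 1) := by rw [hxZ, hzZ]; ring
      linear_combination h6 - e1 + (6 * N ^ 2 * R - 3 * (Z * (Z - 1) - X * (X - 1)) -
        (Z * (Z - 1) * (Z - 2) + X * (X - 1) * (X - 2)) * N) * hNM
    norm_num at h7
  obtain ⟨y', rfl⟩ := Nat.exists_eq_add_of_le hy3
  obtain ⟨δ, D, hδ, hD⟩ : ∃ δ D : ℤ, (δ = 0 ∨ δ = 1) ∧ N ^ y' = δ + N * D := by
    rcases Nat.eq_zero_or_pos y' with h0 | h0
    · exact ⟨1, 0, Or.inr rfl, by rw [h0]; simp⟩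
    · exact ⟨0, N ^ (y' - 1), Or.inl rfl, by rw [zero_add, ← pow_succ']; congr 1; omega⟩
  rw [pow_add, hD] at h5
  have h6 : 6 * (X + Z) + 3 * (Z * (Z - 1) - X * (X - 1)) * N +
      (Z * (Z - 1) * (Z - 2) + X * (X - 1) * (X - 2)) * N ^ 2 + 6 * N ^ 2 * (δ + N * D)
      = 6 * N ^ 3 * R := by
    apply mul_right_cancel₀ hN0; linear_combination h5
  -- N divides x + z
  have h7 : N ∣ X + Z := by
    apply h3 _ _ hcN
    refine ⟨3 * N ^ 2 * R - 3 * (z' - x') * (Z + X - 1) -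
      (Z * (Z - 1) * (Z - 2) + X * (X - 1) * (X - 2)) * (2 * M) - 3 * N * (δ + N * D), ?_⟩
    have e1 : Z * (Z - 1) - X * (X - 1) = 2 * ((z' - x') * (Z + X - 1)) := by
      rw [hxZ, hzZ]; ring
    rw [e1] at h6
    have : (2 : ℤ) ≠ 0 := by norm_num
    apply mul_left_cancel₀ this
    linear_combination h6 - (Z * (Z - 1) * (Z - 2) + X * (X - 1) * (X - 2)) * N * hNM
  obtain ⟨t, ht⟩ := h7
  obtain ⟨s, hs⟩ : ∃ s : ℤ, s = x' - z' := ⟨_, rfl⟩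
  have hXs : X = 2 * M * t + s := by rw [hNM] at ht; linarith
  have hZs : Z = 2 * M * t - s := by rw [hNM] at ht; linarith
  obtain ⟨E, hE⟩ : ∃ E, E = t * (4 * M ^ 2 * t ^ 2 - 6 * M * t + 3 * s ^ 2 + 2) := ⟨_, rfl⟩
  have h8 : 6 * ((t + s) * (1 - s * N)) + N ^ 2 * E + 6 * N * (δ + N * D) = 6 * N ^ 2 * R := by
    apply mul_right_cancel₀ hN0
    rw [hE]
    rw [hXs, hZs] at h6
    rw [hNM] at h6 ⊢
    linear_combination h6
  have hsodd : s % 2 = 1 := by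
    have : X = 2 * (M * t) + s := by rw [hXs]; ring
    omega
  -- t + s is even
  have h9 : N ∣ (t + s) * 2 := by
    have e1 : IsCoprime N (3 * (1 - s * N)) := hcN.mul_right ⟨s, 1, by ring⟩
    apply e1.dvd_of_dvd_mul_right
    exact ⟨6 * N * R - N * E - 6 * (δ + N * D), by linear_combination h8⟩
  obtain ⟨r, hr⟩ := h9
  have htodd : t % 2 = 1 := by
    have : t + s = 2 * (M * r) := by rw [hNM] at hr; linarith
    omega
  have hEodd : E % 2 = 1 := by
    have e1 : Odd (3 * s ^ 2) := by
      have : Odd s := Int.odd_iff.2 hsodd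
      exact (by decide : Odd (3 : ℤ)).mul this.pow
    have e2 : Odd E := by
      rw [hE]
      refine (Int.odd_iff.2 htodd).mul ?_
      have : 4 * M ^ 2 * t ^ 2 - 6 * M * t + 3 * s ^ 2 + 2
        = 3 * s ^ 2 + 2 * (2 * M ^ 2 * t ^ 2 - 3 * M * t + 1) := by ring
      rw [this]
      exact e1.add_even (even_two_mul _)
    exact Int.odd_iff.1 e2
  -- refined
  have h10 : ∃ F : ℤ, t + s + δ * N = 8 * M ^ 2 * F := by
    have hc2 : IsCoprime (8 * M ^ 2) 3 := by
      refine IsCoprime.mul_left ⟨-1, 3, by norm_num⟩ hcM'.pow_left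
    obtain ⟨F, hF⟩ : 8 * M ^ 2 ∣ (t + s + δ * N) := by
      apply h3 _ _ hc2
      refine ⟨6 * R - E - 6 * D + 3 * r * s, ?_⟩
      have e2 : t + s = 2 * M * r := by rw [hNM] at hr; linarith
      have e3 : 3 * ((t + s) * (1 - s * N)) + 8 * M ^ 2 * E + 3 * N * (δ + N * D)
        = 48 * M ^ 2 * R := by
        have : (2 : ℤ) ≠ 0 := by norm_num
        apply mul_left_cancel₀ this
        rw [hNM] at h8 ⊢
        linear_combination h8
      rw [hNM] at e3 ⊢
      linear_combination e3 + 12 * s * M * e2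
    exact ⟨F, hF⟩
  obtain ⟨F, hF⟩ := h10
  have hFodd : F ≠ 0 := by
    rintro rfl
    have e2 : t + s = - δ * N := by linarith
    have e3 : E = 6 * R - 6 * D - 6 * δ * s := by
      have : N ^ 2 ≠ 0 := pow_ne_zero _ hN0
      apply mul_left_cancel₀ this
      rw [e2] at h8
      linear_combination h8
    have e4 : E = 2 * (3 * R - 3 * D - 3 * δ * s) := by rw [e3]; ring
    omega
  have hMpos : 0 < M := by omega
  have hbig : 8 * M ^ 2 ≤ |t + s + δ * N| := by
    rw [hF, abs_mul, abs_of_pos (by positivity : 0 < 8 * M ^ 2)]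
    exact le_mul_of_one_le_right (by positivity) (Int.one_le_abs hFodd)
  by_contra hcon
  push Not at hcon
  obtain ⟨c1, c2⟩ := hcon
  have ht0 : 0 ≤ t := by
    by_contra hneg
    push Not at hneg
    have := mul_neg_of_pos_of_neg hNpos hneg
    linarith
  have ht1 : 16 * t ≤ X + Z := by
    rw [ht]; exact mul_le_mul_of_nonneg_right (by omega) ht0
  have hMN : N ^ 2 = 16 * M ^ 2 := by rw [hNM]; ring
  have hM2 : 4 * M ≤ M ^ 2 := by rw [sq]; exact mul_le_mul_of_nonneg_right (by omega) hMpos.le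
  have hs1 : X - Z = 2 * s := by linarith
  have hδN : 0 ≤ δ * N ∧ δ * N ≤ N := by
    rcases hδ with rfl | rfl <;> constructor <;> linarith
  rcases le_abs.1 hbig with hb | hb
  · linarith
  · linarith

theorem bern (n w : ℕ) (h : 6 * w < n + 3) : (n + 3) ^ w < 2 * n ^ w := by
  have hM : (0 : ℝ) < n + 3 := by positivity
  have h6 : (6 : ℝ) * w < n + 3 := by exact_mod_cast h
  have h1 := one_add_mul_le_pow (a := (-(3 / ((n : ℝ) + 3)))) (by
    have : 3 / ((n : ℝ) + 3) ≤ 1 := by rw [div_le_one hM]; linarith [Nat.cast_nonneg (α := ℝ) n]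
    linarith) w
  have h2 : (1 : ℝ) / 2 < 1 + w * (-(3 / ((n : ℝ) + 3))) := by
    have : w * (3 / ((n : ℝ) + 3)) < 1 / 2 := by
      rw [mul_div_assoc', div_lt_div_iff₀ hM (by norm_num)]; linarith
    linarith
  have h3 : (1 + -(3 / ((n : ℝ) + 3))) = n / (n + 3) := by field_simp; ring
  rw [h3, div_pow] at h1
  have h4 := h2.trans_le h1
  rw [div_lt_div_iff₀ (by norm_num) (by positivity)] at h4
  have h5 : ((n : ℝ) + 3) ^ w < 2 * (n : ℝ) ^ w := by linarith
  exact_mod_cast h5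

theorem w_lower (n x y z w : ℕ) (hn : 2 ≤ n) (hw : 3 ≤ w)
    (heq : n ^ x + (n + 1) ^ y + (n + 2) ^ z = (n + 3) ^ w) : n + 3 ≤ 6 * w := by
  by_contra hlt
  push Not at hlt
  have hb := bern n w hlt
  obtain ⟨v, rfl⟩ : ∃ v, w = v + 1 := ⟨w - 1, by omega⟩
  obtain ⟨T, hT⟩ : ∃ T, T = (n + 2) ^ v := ⟨_, rfl⟩
  have hTpos : 0 < T := by rw [hT]; positivity
  have hB : (n + 2) * T + (v + 1) * T ≤ (n + 3) ^ (v + 1) := by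
    have h1 : 1 + ((v + 1 : ℕ) : ℝ) * (1 / ((n : ℝ) + 2)) ≤ (1 + 1 / ((n : ℝ) + 2)) ^ (v + 1) :=
      one_add_mul_le_pow (by
        have : 0 ≤ 1 / ((n : ℝ) + 2) := by positivity
        linarith) (v + 1)
    have hM : (0 : ℝ) < n + 2 := by positivity
    have h3 : (1 + 1 / ((n : ℝ) + 2)) = (n + 3) / (n + 2) := by field_simp; ring
    rw [h3, div_pow, le_div_iff₀ (by positivity)] at h1
    have h4 : ((n : ℝ) + 2) * (n + 2) ^ v + (v + 1) * (n + 2) ^ v ≤ (n + 3) ^ (v + 1) := by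
      refine le_trans (le_of_eq ?_) h1
      rw [pow_succ]; push_cast; field_simp
    rw [hT]
    exact_mod_cast h4
  have key : ∀ b k : ℕ, n ≤ b → b ≤ n + 2 → b ^ k ≤ (n + 3) ^ (v + 1) →
      b ^ k ≤ T ∨ (n ^ (v + 1) ≤ b ^ k ∧ b ^ k ≤ (n + 2) * T) := by
    intro b k hb1 hb2 hle
    rcases lt_trichotomy k (v + 1) with hk | hk | hk
    · left
      calc b ^ k ≤ (n + 2) ^ k := Nat.pow_le_pow_left hb2 _
        _ ≤ (n + 2) ^ v := Nat.pow_le_pow_right (by omega) (by omega)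
        _ = T := hT.symm
    · right
      rw [hk]
      refine ⟨Nat.pow_le_pow_left hb1 _, (Nat.pow_le_pow_left hb2 _).trans ?_⟩
      rw [pow_succ, hT, mul_comm]
    · exfalso
      have h1 : 2 * n ^ (v + 1) ≤ b ^ k := by
        calc 2 * n ^ (v + 1) ≤ n * n ^ (v + 1) := Nat.mul_le_mul_right _ hn
          _ = n ^ (v + 2) := by ring
          _ ≤ b ^ (v + 2) := Nat.pow_le_pow_left hb1 _
          _ ≤ b ^ k := Nat.pow_le_pow_right (by omega) (by omega)
      omega
  have k1 := key n x le_rfl (by omega) (by omega)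
  have k2 := key (n + 1) y (by omega) (by omega) (by omega)
  have k3 := key (n + 2) z (by omega) (by omega) (by omega)
  have hvT : 3 * T ≤ (v + 1) * T := Nat.mul_le_mul_right _ hw
  have hnT : 4 * T ≤ (n + 2) * T := Nat.mul_le_mul_right _ (by omega)
  rcases k1 with k1 | k1 <;> rcases k2 with k2 | k2 <;> rcases k3 with k3 | k3 <;> omega

theorem exp_le (n b k w : ℕ) (hn : 5 ≤ n) (hb : n ≤ b) (h : b ^ k ≤ (n + 3) ^ w) : k ≤ 2 * w := by
  have h1 : n ^ k ≤ n ^ (2 * w) := by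
    calc n ^ k ≤ b ^ k := Nat.pow_le_pow_left hb _
      _ ≤ (n + 3) ^ w := h
      _ ≤ (n ^ 2) ^ w := Nat.pow_le_pow_left (by nlinarith) _
      _ = n ^ (2 * w) := by rw [pow_mul]
  exact (Nat.pow_le_pow_iff_right (by omega)).1 h1

theorem four_big (e : ℕ) (he : 9 ≤ e) : 48 * e + 261000 ≤ 4 ^ e := by
  induction e, he using Nat.le_induction with
  | base => norm_num
  | succ k hk ih => rw [pow_succ]; linarith

theorem parity (e x y z w : ℕ) (he : 9 ≤ e) (hx : 0 < x) (hy : 0 < y) (hz : 0 < z) (hw : 0 < w)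
    (heq : ((4 : ℤ) ^ e - 1) ^ x + (4 ^ e) ^ y + (4 ^ e + 1) ^ z = (4 ^ e + 2) ^ w) :
    Odd x ∧ Odd y ∧ Odd z ∧ 2 * e ≤ w := by
  have hbigN := four_big e he
  obtain ⟨N, hN⟩ : ∃ N : ℤ, N = 4 ^ e := ⟨_, rfl⟩
  have hNbig : 262144 ≤ N := by
    rw [hN]
    calc (262144 : ℤ) = 4 ^ 9 := by norm_num
      _ ≤ 4 ^ e := pow_le_pow_right₀ (by norm_num) he
  rw [← hN] at heq
  have hN4 : (4 : ℤ) ∣ N := by rw [hN]; exact dvd_pow_self _ (by omega)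
  have hN3 : (3 : ℤ) ∣ N - 1 := by
    rw [hN]; exact (by norm_num : (3 : ℤ) ∣ 4 - 1).trans (by simpa using sub_dvd_pow_sub_pow (4 : ℤ) 1 e)
  have hw2 : 2 ≤ w := by
    by_contra hlt
    have hw1 : w = 1 := by omega
    rw [hw1, pow_one] at heq
    have h1 : N - 1 ≤ (N - 1) ^ x := le_self_pow₀ (by omega) hx.ne'
    have h2 : N ≤ N ^ y := le_self_pow₀ (by omega) hy.ne'
    have h3 : N + 1 ≤ (N + 1) ^ z := le_self_pow₀ (by omega) hz.ne'
    omega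
  -- modulo N
  have m1 : N ∣ (N - 1) ^ x - (-1) ^ x := (by simp : N ∣ (N - 1) - (-1)).trans (sub_dvd_pow_sub_pow _ _ _)
  have m2 : N ∣ N ^ y := dvd_pow_self _ hy.ne'
  have m3 : N ∣ (N + 1) ^ z - 1 := by
    have := sub_dvd_pow_sub_pow (N + 1) 1 z
    simpa using this
  have m4 : N ∣ (N + 2) ^ w - 2 ^ w := (by simp : N ∣ (N + 2) - 2).trans (sub_dvd_pow_sub_pow _ _ _)
  have m5 : N ∣ 2 ^ w - (-1) ^ x - 1 := by
    have := dvd_sub (dvd_add (dvd_add m1 m2) m3) m4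
    have e1 : (2 : ℤ) ^ w - (-1) ^ x - 1 = (N - 1) ^ x - (-1) ^ x + N ^ y + ((N + 1) ^ z - 1) -
      ((N + 2) ^ w - 2 ^ w) := by linear_combination -heq
    rw [e1]; exact this
  have hxo : Odd x := by
    by_contra hcon
    have hev := Nat.not_odd_iff_even.1 hcon
    rw [hev.neg_one_pow] at m5
    have h4 := hN4.trans m5
    have h5 : (4 : ℤ) ∣ 2 ^ w := (by norm_num : (4 : ℤ) = 2 ^ 2) ▸ pow_dvd_pow 2 hw2
    omega
  rw [hxo.neg_one_pow] at m5
  have m6 : N ∣ 2 ^ w := by simpa using m5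
  have hwe : 2 * e ≤ w := by
    rw [hN, show (4 : ℤ) = 2 ^ 2 by norm_num, ← pow_mul] at m6
    have m7 : 2 ^ (2 * e) ∣ 2 ^ w := by exact_mod_cast m6
    exact (Nat.pow_dvd_pow_iff_le_right (by norm_num)).1 m7
  have hzo : Odd z := by
    by_contra hcon
    have hev := Nat.not_odd_iff_even.1 hcon
    have t1 : (3 : ℤ) ∣ (N - 1) ^ x := dvd_pow hN3 hx.ne'
    have t2 : (3 : ℤ) ∣ N ^ y - 1 := hN3.trans (by simpa using sub_dvd_pow_sub_pow N 1 y)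
    have t3 : (3 : ℤ) ∣ (N + 1) ^ z - (-1) ^ z :=
      (by omega : (3 : ℤ) ∣ (N + 1) - (-1)).trans (sub_dvd_pow_sub_pow _ _ _)
    have t4 : (3 : ℤ) ∣ (N + 2) ^ w := dvd_pow (by omega) hw.ne'
    rw [hev.neg_one_pow] at t3
    omega
  have hyo : Odd y := by
    by_contra hcon
    have hev := Nat.not_odd_iff_even.1 hcon
    have t1 : N + 1 ∣ (N - 1) ^ x - (-2) ^ x :=
      (Dvd.intro 1 (by ring) : N + 1 ∣ (N - 1) - (-2)).trans (sub_dvd_pow_sub_pow _ _ _)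
    have t2 : N + 1 ∣ N ^ y - (-1) ^ y :=
      (Dvd.intro 1 (by ring) : N + 1 ∣ N - (-1)).trans (sub_dvd_pow_sub_pow _ _ _)
    have t3 : N + 1 ∣ (N + 1) ^ z := dvd_pow_self _ hz.ne'
    have t4 : N + 1 ∣ (N + 2) ^ w - 1 := by
      have := sub_dvd_pow_sub_pow (N + 2) 1 w
      rw [one_pow] at this
      exact (Dvd.intro 1 (by ring) : N + 1 ∣ (N + 2) - 1).trans this
    rw [hev.neg_one_pow] at t2
    have t5 : N + 1 ∣ (-2) ^ x := by
      have := dvd_sub t4 (dvd_add (dvd_add t1 t2) t3)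
      have e1 : (-2 : ℤ) ^ x = (N + 2) ^ w - 1 - ((N - 1) ^ x - (-2) ^ x + (N ^ y - 1) + (N + 1) ^ z) := by
        linear_combination heq
      rw [e1]; exact this
    have hco : IsCoprime (N + 1) ((-2) ^ x) := by
      obtain ⟨M, hM⟩ := hN4
      refine IsCoprime.pow_right ⟨1, 2 * M, by rw [hM]; ring⟩
    have := hco.isUnit_of_dvd' dvd_rfl t5
    rw [Int.isUnit_iff] at this
    omega
  exact ⟨hxo, hyo, hzo, hwe⟩

theorem w_big (e x y z w : ℕ) (he : 9 ≤ e) (hx : 0 < x) (hy : 0 < y) (hz : 0 < z) (hw : 0 < w)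
    (heq : (4 ^ e - 1) ^ x + (4 ^ e) ^ y + (4 ^ e + 1) ^ z = (4 ^ e + 2) ^ w)
    (heqZ : ((4 : ℤ) ^ e - 1) ^ x + (4 ^ e) ^ y + (4 ^ e + 1) ^ z = (4 ^ e + 2) ^ w) :
    x ≤ 2 * w ∧ y ≤ 2 * w ∧ z ≤ 2 * w ∧ (4 ^ e) ^ 2 ≤ 4 * w := by
  obtain ⟨hxo, hyo, hzo, hwe⟩ := parity e x y z w he hx hy hz hw heqZ
  have hbigN := four_big e he
  obtain ⟨n, hn⟩ : ∃ n, 4 ^ e = n + 1 := ⟨4 ^ e - 1, by omega⟩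
  have heq' := heq
  rw [hn] at heq'
  simp only [Nat.add_sub_cancel, add_assoc, Nat.reduceAdd] at heq'
  rw [← add_assoc] at heq'
  have h1 := w_lower n x y z w (by omega) (by omega) heq'
  have hx2 := exp_le n n x w (by omega) le_rfl (by omega)
  have hy2 := exp_le n (n + 1) y w (by omega) (by omega) (by omega)
  have hz2 := exp_le n (n + 2) z w (by omega) (by omega) (by omega)
  refine ⟨hx2, hy2, hz2, ?_⟩
  have hw8 : 8 * e ≤ w := by omega
  have hd : ((4 : ℤ) ^ e) ^ 4 ∣ (4 ^ e + 2) ^ w := by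
    have e1 : ((4 : ℤ) ^ e) ^ 4 = 2 ^ (8 * e) := by
      rw [show (4 : ℤ) = 2 ^ 2 by norm_num, ← pow_mul, ← pow_mul]; congr 1; ring
    rw [e1]
    refine (pow_dvd_pow 2 hw8).trans (pow_dvd_pow_of_dvd ?_ w)
    exact dvd_add (dvd_pow (by norm_num) (by omega)) dvd_rfl
  have h2 := two_adic_s15 e x y z (by omega) hxo hyo hzo (by
    have e1 : (1 + (4 : ℤ) ^ e) ^ z + (4 ^ e) ^ y - (1 - 4 ^ e) ^ x = (4 ^ e + 2) ^ w := by
      rw [← heqZ, show (1 - (4 : ℤ) ^ e) = -(4 ^ e - 1) by ring, hxo.neg_pow]; ring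
    rw [e1]; exact hd)
  rcases h2 with h2 | h2
  · have : (4 ^ e) ^ 2 ≤ 2 * x := by exact_mod_cast h2
    omega
  · have : (4 ^ e) ^ 2 ≤ 2 * z := by exact_mod_cast h2
    omega

theorem y_and_x_small (e x y z w : ℕ) (he : 9 ≤ e) (hx : 0 < x) (hy : 0 < y) (hz : 0 < z) (hw : 0 < w)
    (heq : (4 ^ e - 1) ^ x + 4 ^ (e * y) + (4 ^ e + 1) ^ z = (4 ^ e + 2) ^ w) :
    (y : ℝ) < (w : ℝ) / 2 ∧ (x : ℝ) < (w : ℝ) / 2 := by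
  rw [pow_mul] at heq
  have hbigN := four_big e he
  have heqZ : ((4 : ℤ) ^ e - 1) ^ x + (4 ^ e) ^ y + (4 ^ e + 1) ^ z = (4 ^ e + 2) ^ w := by
    have h1 : ((4 ^ e - 1 : ℕ) : ℤ) = (4 : ℤ) ^ e - 1 := by
      rw [Nat.cast_sub (by omega)]; push_cast; rfl
    rw [← h1]
    exact_mod_cast heq
  obtain ⟨hxo, hyo, hzo, hwe⟩ := parity e x y z w he hx hy hz hw heqZ
  obtain ⟨hx2, hy2, hz2, hw4⟩ := w_big e x y z w he hx hy hz hw heq heqZ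
  obtain ⟨h, hh1, hh2⟩ : ∃ h, 2 ^ h ≤ 2 * w ∧ w < 2 ^ h := by
    refine ⟨Nat.log 2 w + 1, ?_, Nat.lt_pow_succ_log_self (by norm_num) w⟩
    have := Nat.pow_log_le_self 2 hw.ne'
    rw [pow_succ]; omega
  have hN2 : 2 ^ 36 ≤ (4 ^ e) ^ 2 := by
    calc 2 ^ 36 = (4 ^ 9) ^ 2 := by norm_num
      _ ≤ (4 ^ e) ^ 2 := Nat.pow_le_pow_left (Nat.pow_le_pow_right (by norm_num) he) 2
  have hh : 34 ≤ h := by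
    have h1 : 2 ^ 34 < 2 ^ h := by
      refine lt_of_le_of_lt ?_ hh2
      norm_num at hN2 ⊢
      omega
    exact ((Nat.pow_lt_pow_iff_right (by norm_num)).1 h1).le
  have hB : 2 * w ≤ 2 ^ (h + 1) := by rw [pow_succ]; omega
  have hnum := numeric_aux h hh
  have hh4 : h + 1 ≤ h ^ 4 := by
    have e2 : 1 ≤ h ^ 2 := Nat.one_le_pow _ _ (by omega)
    calc h + 1 ≤ h * h := by nlinarith
      _ = h ^ 2 * 1 := by ring
      _ ≤ h ^ 2 * h ^ 2 := Nat.mul_le_mul_left _ e2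
      _ = h ^ 4 := by ring
  obtain ⟨V, hV1, hV2⟩ : ∃ V, 2 * V ≤ w ∧ w ≤ 2 * V + 1 := ⟨w / 2, by omega, by omega⟩
  have hVbig : 256 * h ^ 4 + (h + 1) ≤ V := by omega
  have hA : (4 ^ e + 1) ^ 2 ≤ 2 ^ (h + 3) := by
    have h1 : (4 ^ e + 1) ^ 2 ≤ 2 * (4 ^ e) ^ 2 := by nlinarith
    rw [pow_add]; omega
  obtain ⟨N, hN⟩ : ∃ N : ℤ, N = 4 ^ e := ⟨_, rfl⟩
  have hAN : ((4 ^ e + 1 : ℕ) : ℤ) = N + 1 := by rw [hN]; push_cast; rfl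
  have hNbig : 262144 ≤ N := by
    rw [hN]
    calc (262144 : ℤ) = 4 ^ 9 := by norm_num
      _ ≤ 4 ^ e := pow_le_pow_right₀ (by norm_num) he
  have hN4 : (4 : ℤ) ∣ N := by rw [hN]; exact dvd_pow_self _ (by omega)
  have hN3 : (3 : ℤ) ∣ N - 1 := by
    rw [hN]; exact (by norm_num : (3 : ℤ) ∣ 4 - 1).trans (by simpa using sub_dvd_pow_sub_pow (4 : ℤ) 1 e)
  have hN44 : (4 : ℤ) ^ V ∣ N ^ V := pow_dvd_pow_of_dvd hN4 V
  rw [← hN] at heqZ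
  have hu : ∀ c : ℤ, 2 ≤ |c| → ¬ IsUnit c := by
    intro c hc hcu
    rw [Int.isUnit_iff_abs_eq] at hcu
    omega
  constructor
  · by_contra hcon
    push Not at hcon
    have hyw : w ≤ 2 * y := by
      have : (w : ℝ) ≤ 2 * y := by linarith
      exact_mod_cast this
    have hd : (4 : ℤ) ^ V ∣ (N + 1) ^ z - (1 - N) ^ x := by
      have d1 : (4 : ℤ) ^ V ∣ N ^ y := hN44.trans (pow_dvd_pow N (by omega))
      have d2 : (4 : ℤ) ^ V ∣ (N + 2) ^ w := by
        rw [show (4 : ℤ) = 2 ^ 2 by norm_num, ← pow_mul]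
        exact (pow_dvd_pow 2 hV1).trans (pow_dvd_pow_of_dvd (by omega) w)
      have e1 : (N + 1) ^ z - (1 - N) ^ x = (N + 2) ^ w - N ^ y := by
        rw [← heqZ, show (1 - N) = -(N - 1) by ring, hxo.neg_pow]; ring
      rw [e1]; exact dvd_sub d2 d1
    refine core4 (N + 1) (1 - N) V z x h (4 ^ e + 1) (by simpa using hN4) (by simpa using hN4)
      (by omega) (by omega) (hu _ ?_) (hu _ ?_) ?_ ?_ ?_ hA hzo hxo (by omega) (by omega) hh
      (by omega) hd
    · rw [abs_of_pos (by omega)]; omega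
    · rw [abs_of_neg (by omega)]; omega
    · obtain ⟨M, hM⟩ := hN4
      exact ⟨1 - 2 * M, -2 * M, by rw [hM]; ring⟩
    · rw [hAN, abs_of_pos (by omega)]
    · rw [hAN, abs_of_neg (by omega)]; omega
  · by_contra hcon
    push Not at hcon
    have hxw : w ≤ 2 * x := by
      have : (w : ℝ) ≤ 2 * x := by linarith
      exact_mod_cast this
    have hd : (3 : ℤ) ^ V ∣ (-(N + 1)) ^ z - N ^ y := by
      have d1 : (3 : ℤ) ^ V ∣ (N - 1) ^ x :=
        (pow_dvd_pow_of_dvd hN3 V).trans (pow_dvd_pow _ (by omega))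
      have d2 : (3 : ℤ) ^ V ∣ (N + 2) ^ w :=
        (pow_dvd_pow_of_dvd (by omega) V).trans (pow_dvd_pow _ (by omega))
      have e1 : (-(N + 1)) ^ z - N ^ y = (N - 1) ^ x - (N + 2) ^ w := by
        rw [← heqZ, hzo.neg_pow]; ring
      rw [e1]; exact dvd_sub d1 d2
    refine core3 (-(N + 1)) N V z y h (4 ^ e + 1) (by omega) hN3
      (by omega) (by omega) (hu _ ?_) (hu _ ?_) ?_ ?_ ?_ hA hz hy (by omega) (by omega) hh
      hVbig hd
    · rw [abs_of_neg (by omega)]; omega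
    · rw [abs_of_pos (by omega)]; omega
    · exact ⟨-1, -1, by ring⟩
    · rw [hAN, abs_of_neg (by omega)]; omega
    · rw [hAN, abs_of_pos (by omega)]; omega
end
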